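/- Let d = 2. There exist η₀ > 0 and a universal constant C ≥ 1 such that: if v is a solution of the hodograph PDE on H₁ = {y : y₂ ≥ 0, |y| ≥ 1} with |∇v(y)| ≤ η₀ on H₁ and v is bounded from below, then for all y ∈ H₁ with |y| ≥ 2 one has 0 ≤ v(y) − min_{∂B₁⁺} v ≤ C(1+log|y|)·(min_{∂B₂⁺} v − min_{∂B₁⁺} v). Similarly, if v is bounded from above, then for all y ∈ H₁ with |y| ≥ 2 one has 0 ≥ v(y) − max_{∂B₁⁺} v ≥ −C(1+log|y|)·(max_{∂B₁⁺} v − max_{∂B₂⁺} v). -/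

import Mathlib

open Real Set Filter MeasureTheory

noncomputable section

/-- The last index of `Fin d`. -/
def lastIdx (d : ℕ) (hd : 0 < d) : Fin d := ⟨d - 1, by omega⟩

/-- The `i`-th partial derivative of `v` at `y`. -/
def gradC (d : ℕ) (v : EuclideanSpace ℝ (Fin d) → ℝ)
    (y : EuclideanSpace ℝ (Fin d)) (i : Fin d) : ℝ :=
  fderiv ℝ v y (EuclideanSpace.single i 1)

/-- The `(i,j)` entry of the Hessian of `v` at `y`. -/
def hessC (d : ℕ) (v : EuclideanSpace ℝ (Fin d) → ℝ)
    (y : EuclideanSpace ℝ (Fin d)) (i j : Fin d) : ℝ :=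
  fderiv ℝ (fun z => fderiv ℝ v z (EuclideanSpace.single i 1)) y (EuclideanSpace.single j 1)

/-- The squared euclidean norm of the tangential part `p'` of `p`. -/
def tangSq (d : ℕ) (hd : 0 < d) (p : Fin d → ℝ) : ℝ :=
  ∑ m : Fin d, if m = lastIdx d hd then 0 else (p m) ^ 2

/-- The coefficient matrix `A(p)` of the hodograph PDE. -/
def hodA (d : ℕ) (hd : 0 < d) (p : Fin d → ℝ) (i j : Fin d) : ℝ :=
  if i = lastIdx d hd then
    (if j = lastIdx d hd then (1 + tangSq d hd p) / (1 + p (lastIdx d hd)) ^ 2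
     else p j / (1 + p (lastIdx d hd)))
  else
    (if j = lastIdx d hd then p i / (1 + p (lastIdx d hd))
     else if i = j then 1 else 0)

/-- The boundary nonlinearity `N(p') = √(1 + |p'|²) - 1`. -/
def hodN (d : ℕ) (hd : 0 < d) (p : Fin d → ℝ) : ℝ :=
  Real.sqrt (1 + tangSq d hd p) - 1

/-- The quantity `tr(A(∇v(y)) D²v(y))`. -/
def hodOp (d : ℕ) (hd : 0 < d) (v : EuclideanSpace ℝ (Fin d) → ℝ)
    (y : EuclideanSpace ℝ (Fin d)) : ℝ :=
  ∑ i : Fin d, ∑ j : Fin d, hodA d hd (fun m => gradC d v y m) i j * hessC d v y i j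

/-- `v` is `C^∞` on an open neighborhood of `U`. -/
def SmoothNear (d : ℕ) (v : EuclideanSpace ℝ (Fin d) → ℝ)
    (U : Set (EuclideanSpace ℝ (Fin d))) : Prop :=
  ∃ W : Set (EuclideanSpace ℝ (Fin d)), IsOpen W ∧ U ⊆ W ∧ ContDiffOn ℝ (⊤ : ℕ∞) v W

/-- `v` is a (classical) solution of the hodograph PDE on `U`. -/
def IsHodSol (d : ℕ) (hd : 0 < d) (v : EuclideanSpace ℝ (Fin d) → ℝ)
    (U : Set (EuclideanSpace ℝ (Fin d))) : Prop :=
  SmoothNear d v U ∧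
  (∀ y ∈ U, 0 < y (lastIdx d hd) → hodOp d hd v y = 0) ∧
  (∀ y ∈ U, y (lastIdx d hd) = 0 →
    gradC d v y (lastIdx d hd) = hodN d hd (fun m => gradC d v y m))

/-- `v` is a subsolution of the hodograph PDE on `U`. -/
def IsHodSubsol (d : ℕ) (hd : 0 < d) (v : EuclideanSpace ℝ (Fin d) → ℝ)
    (U : Set (EuclideanSpace ℝ (Fin d))) : Prop :=
  SmoothNear d v U ∧
  (∀ y ∈ U, 0 < y (lastIdx d hd) → 0 ≤ hodOp d hd v y) ∧
  (∀ y ∈ U, y (lastIdx d hd) = 0 →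
    hodN d hd (fun m => gradC d v y m) ≤ gradC d v y (lastIdx d hd))

/-- `v` is a supersolution of the hodograph PDE on `U`. -/
def IsHodSupersol (d : ℕ) (hd : 0 < d) (v : EuclideanSpace ℝ (Fin d) → ℝ)
    (U : Set (EuclideanSpace ℝ (Fin d))) : Prop :=
  SmoothNear d v U ∧
  (∀ y ∈ U, 0 < y (lastIdx d hd) → hodOp d hd v y ≤ 0) ∧
  (∀ y ∈ U, y (lastIdx d hd) = 0 →
    gradC d v y (lastIdx d hd) ≤ hodN d hd (fun m => gradC d v y m))

/-- The exterior half-space domain `H₁ = {y : y_d ≥ 0, |y| ≥ 1}`. -/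
def extDom (d : ℕ) (hd : 0 < d) : Set (EuclideanSpace ℝ (Fin d)) :=
  {y | 0 ≤ y (lastIdx d hd) ∧ 1 ≤ ‖y‖}

/-- The half annulus `A_r = {y : 1 ≤ |y| ≤ r, y_d ≥ 0}`. -/
def halfAnn (d : ℕ) (hd : 0 < d) (r : ℝ) : Set (EuclideanSpace ℝ (Fin d)) :=
  {y | 0 ≤ y (lastIdx d hd) ∧ 1 ≤ ‖y‖ ∧ ‖y‖ ≤ r}

/-- The upper half sphere `∂B_ρ⁺ = {y : y_d ≥ 0, |y| = ρ}`. -/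
def upSphere (d : ℕ) (hd : 0 < d) (ρ : ℝ) : Set (EuclideanSpace ℝ (Fin d)) :=
  {y | 0 ≤ y (lastIdx d hd) ∧ ‖y‖ = ρ}

/-- The filter of `|y| → ∞` within `H₁`. -/
def farFilter (d : ℕ) (hd : 0 < d) : Filter (EuclideanSpace ℝ (Fin d)) :=
  (Filter.comap (fun y : EuclideanSpace ℝ (Fin d) => ‖y‖) Filter.atTop) ⊓
    Filter.principal (extDom d hd)

/-- The exterior of the unit disc in the closed upper half plane, in coordinates. -/
def planeDom : Set (ℝ × ℝ) := {z | 0 ≤ z.2 ∧ 1 ≤ z.1 ^ 2 + z.2 ^ 2}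

/-- A solution `V` of the planar hodograph problem, with gradient `(P, Q)` and Hessian entries
`R, S, T`. -/
structure PlaneSol (V P Q R S T : ℝ × ℝ → ℝ) : Prop where
  dV : ∀ z ∈ planeDom, HasFDerivAt V
    (P z • ContinuousLinearMap.fst ℝ ℝ ℝ + Q z • ContinuousLinearMap.snd ℝ ℝ ℝ) z
  dP : ∀ z ∈ planeDom, HasFDerivAt P
    (R z • ContinuousLinearMap.fst ℝ ℝ ℝ + S z • ContinuousLinearMap.snd ℝ ℝ ℝ) z
  dQ : ∀ z ∈ planeDom, HasFDerivAt Q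
    (S z • ContinuousLinearMap.fst ℝ ℝ ℝ + T z • ContinuousLinearMap.snd ℝ ℝ ℝ) z
  cR : ContinuousOn R planeDom
  cS : ContinuousOn S planeDom
  cT : ContinuousOn T planeDom
  pde : ∀ z ∈ planeDom, 0 < z.2 →
    R z + 2 * (P z / (1 + Q z)) * S z + (1 + P z ^ 2) / (1 + Q z) ^ 2 * T z = 0
  bc : ∀ z ∈ planeDom, z.2 = 0 → Q z = √(1 + P z ^ 2) - 1

lemma hasDerivAt_along_curve {V : ℝ × ℝ → ℝ} {p q : ℝ} {x y : ℝ → ℝ} {x' y' t : ℝ}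
    (hV : HasFDerivAt V
      (p • ContinuousLinearMap.fst ℝ ℝ ℝ + q • ContinuousLinearMap.snd ℝ ℝ ℝ) (x t, y t))
    (hx : HasDerivAt x x' t) (hy : HasDerivAt y y' t) :
    HasDerivAt (fun s => V (x s, y s)) (p * x' + q * y') t := by
  have := hV.comp_hasDerivAt t (hx.prodMk hy)
  simpa [Function.comp_def] using this

/-- Necessary second order condition at a local minimum. -/
lemma second_deriv_nonneg_of_isLocalMin {f f' : ℝ → ℝ} {c : ℝ}
    (h1 : ∀ᶠ t in nhds (0 : ℝ), HasDerivAt f (f' t) t) (h2 : HasDerivAt f' c 0)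
    (hm : IsLocalMin f 0) : 0 ≤ c := by
  by_contra! hc
  have hd : deriv f =ᶠ[nhds 0] f' := h1.mono fun t ht => ht.deriv
  have hdd : deriv (deriv f) 0 = c := by rw [hd.deriv_eq, h2.deriv]
  have hmax : IsLocalMax f 0 := by
    have := isLocalMin_of_deriv_deriv_pos (f := fun t => - f t) (x₀ := 0) ?_ ?_ ?_
    · simpa using this.neg
    · have : deriv (fun t => - f t) = fun t => - deriv f t := by ext; simp
      rw [this]; simp [deriv.fun_neg, hdd, hc]
    · have : deriv (fun t => - f t) = fun t => - deriv f t := by ext; simp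
      rw [this]; simp [hm.deriv_eq_zero]
    · exact h1.self_of_nhds.continuousAt.neg
  have hconst : f =ᶠ[nhds 0] fun _ => f 0 := by
    filter_upwards [hm, hmax] with t h h' using le_antisymm h' h
  have h0 : deriv f =ᶠ[nhds 0] fun _ => 0 := by
    have := hconst.deriv
    simpa using this
  have : deriv (deriv f) 0 = 0 := by rw [h0.deriv_eq]; simp
  linarith

/-- The explicit barrier. -/
def barrier (τ : ℝ) (z : ℝ × ℝ) : ℝ :=
  τ / 2 * log (z.1 ^ 2 + z.2 ^ 2) + (√(z.1 ^ 2 + z.2 ^ 2))⁻¹ - 1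
    + (z.2 / (z.1 ^ 2 + z.2 ^ 2) - 1) / 10

lemma hasDerivAt_barrier_line (τ : ℝ) {x y e f : ℝ} {t : ℝ}
    (h : 0 < (x + t * e) ^ 2 + (y + t * f) ^ 2) :
    HasDerivAt (fun t => barrier τ (x + t * e, y + t * f))
      (τ * ((x + t * e) * e + (y + t * f) * f) / ((x + t * e) ^ 2 + (y + t * f) ^ 2)
        - ((x + t * e) * e + (y + t * f) * f) / (√((x + t * e) ^ 2 + (y + t * f) ^ 2)) ^ 3
        + (f / ((x + t * e) ^ 2 + (y + t * f) ^ 2)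
          - 2 * (y + t * f) * ((x + t * e) * e + (y + t * f) * f)
            / ((x + t * e) ^ 2 + (y + t * f) ^ 2) ^ 2) / 10) t := by
  have hx : HasDerivAt (fun t => x + t * e) e t := by
    simpa using ((hasDerivAt_id t).mul_const e).const_add x
  have hy : HasDerivAt (fun t => y + t * f) f t := by
    simpa using ((hasDerivAt_id t).mul_const f).const_add y
  have hρ := (hx.pow 2).add (hy.pow 2)
  have hs : 0 < √((x + t * e) ^ 2 + (y + t * f) ^ 2) := sqrt_pos.2 h
  have hs2 := sq_sqrt h.le
  have key := ((((hρ.log h.ne').const_mul (τ / 2)).add ((hρ.sqrt h.ne').inv hs.ne')).sub_const 1).add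
    (((hy.div hρ h.ne').sub_const 1).div_const 10)
  refine key.congr_deriv ?_
  set ρ := (x + t * e) ^ 2 + (y + t * f) ^ 2 with hρd
  simp only [Pi.add_apply, Pi.pow_apply, ← hρd]
  set r := √ρ
  have hr : ρ = r ^ 2 := hs2.symm
  rw [hr]
  field_simp
  push_cast
  ring

lemma hasDerivAt_barrier_line_deriv (τ : ℝ) {x y e f : ℝ}
    (h : 0 < x ^ 2 + y ^ 2) :
    HasDerivAt (fun t => τ * ((x + t * e) * e + (y + t * f) * f) / ((x + t * e) ^ 2 + (y + t * f) ^ 2)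
        - ((x + t * e) * e + (y + t * f) * f) / (√((x + t * e) ^ 2 + (y + t * f) ^ 2)) ^ 3
        + (f / ((x + t * e) ^ 2 + (y + t * f) ^ 2)
          - 2 * (y + t * f) * ((x + t * e) * e + (y + t * f) * f)
            / ((x + t * e) ^ 2 + (y + t * f) ^ 2) ^ 2) / 10)
      (τ * ((e ^ 2 + f ^ 2) / (x ^ 2 + y ^ 2) - 2 * (x * e + y * f) ^ 2 / (x ^ 2 + y ^ 2) ^ 2)
        - (e ^ 2 + f ^ 2) / (√(x ^ 2 + y ^ 2)) ^ 3
        + 3 * (x * e + y * f) ^ 2 / (√(x ^ 2 + y ^ 2)) ^ 5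
        + (- 4 * f * (x * e + y * f) / (x ^ 2 + y ^ 2) ^ 2
          - 2 * y * (e ^ 2 + f ^ 2) / (x ^ 2 + y ^ 2) ^ 2
          + 8 * y * (x * e + y * f) ^ 2 / (x ^ 2 + y ^ 2) ^ 3) / 10) 0 := by
  have hx : HasDerivAt (fun t => x + t * e) e 0 := by
    simpa using ((hasDerivAt_id (0:ℝ)).mul_const e).const_add x
  have hy : HasDerivAt (fun t => y + t * f) f 0 := by
    simpa using ((hasDerivAt_id (0:ℝ)).mul_const f).const_add y
  have hρ := (hx.pow 2).add (hy.pow 2)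
  have hm := (hx.mul_const e).add (hy.mul_const f)
  have hs : 0 < √(x ^ 2 + y ^ 2) := sqrt_pos.2 h
  have hs2 := sq_sqrt h.le
  have h0 : (x + 0 * e) ^ 2 + (y + 0 * f) ^ 2 ≠ 0 := by simpa using h.ne'
  have hs0 : √((x + 0 * e) ^ 2 + (y + 0 * f) ^ 2) ≠ 0 := by simpa using hs.ne'
  have key := ((((hm.const_mul τ).div hρ h0)).sub (hm.div ((hρ.sqrt h0).pow 3) (pow_ne_zero 3 hs0))).add
    ((((hasDerivAt_const (0:ℝ) f).div hρ h0).sub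
      (((hy.const_mul 2).mul hm).div (hρ.pow 2) (pow_ne_zero 2 h0))).div_const 10)
  refine key.congr_deriv ?_
  simp only [Pi.add_apply, Pi.pow_apply, zero_mul, add_zero, Pi.mul_apply]
  set ρ := x ^ 2 + y ^ 2 with hρd
  set r := √ρ
  have hr : ρ = r ^ 2 := hs2.symm
  rw [hr]
  field_simp
  push_cast
  ring

lemma barrier_cross_bounds {τ i u w : ℝ} (hτ : |τ| ≤ 1) (hi : 0 < i) (hi1 : i ≤ 1)
    (huw : u ^ 2 + w ^ 2 = 1) :
    |τ * (-2 * u * w) + i * (3 * u * w + (-2 * u + 8 * u * w ^ 2) / 10)| ≤ 5 ∧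
    |τ * (1 - 2 * w ^ 2) + i * (- 1 + 3 * w ^ 2 + (- 6 * w + 8 * w ^ 3) / 10)| ≤ 9 ∧
    |τ * u - i * u - 2 * i * u * w / 10| ≤ 3 ∧
    |τ * w - i * w + i * (1 - 2 * w ^ 2) / 10| ≤ 3 := by
  have hu : |u| ≤ 1 := abs_le_one_iff_mul_self_le_one.2 (by nlinarith)
  have hw : |w| ≤ 1 := abs_le_one_iff_mul_self_le_one.2 (by nlinarith)
  have hw2 : w ^ 2 ≤ 1 := by nlinarith
  have huwb : |u * w| ≤ 1 / 2 := by
    rw [abs_le]; constructor <;> nlinarith [sq_nonneg (u + w), sq_nonneg (u - w)]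
  have hiabs : |i| ≤ 1 := by rwa [abs_of_pos hi]
  have prod : ∀ {a b A B : ℝ}, |a| ≤ A → |b| ≤ B → |a * b| ≤ A * B := fun ha hb => by
    rw [abs_mul]; exact mul_le_mul ha hb (abs_nonneg _) ((abs_nonneg _).trans ha)
  have b1 := prod hτ huwb
  have b2 := prod hiabs huwb
  have b3 := prod hiabs hu
  have b4 : |w ^ 2| ≤ 1 := by rwa [abs_of_nonneg (sq_nonneg w)]
  have b5 := prod b3 b4
  have b6 := prod hτ b4
  have b7 := prod hiabs b4
  have b8 := prod hiabs hw
  have b9 := prod b8 b4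
  have b10 := prod hτ hu
  have b11 := prod hτ hw
  have b12 := prod b2 hw
  simp only [abs_le] at *
  refine ⟨⟨?_, ?_⟩, ⟨?_, ?_⟩, ⟨?_, ?_⟩, ⟨?_, ?_⟩⟩ <;> linarith

lemma coefficient_bounds {p q k : ℝ} (hp : |p| ≤ k) (hq : |q| ≤ k) (hk : k ≤ 1 / 100) :
    |p / (1 + q)| ≤ 2 * k ∧ |(1 + p ^ 2) / (1 + q) ^ 2 - 1| ≤ 4 * k := by
  have hk0 : 0 ≤ k := (abs_nonneg p).trans hp
  have hq' := abs_le.1 hq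
  have hp' := abs_le.1 hp
  have h1 : 0 < 1 + q := by linarith
  constructor
  · rw [abs_div, abs_of_pos h1, div_le_iff₀ h1]; nlinarith
  · have : (1 + p ^ 2) / (1 + q) ^ 2 - 1 = (p ^ 2 - 2 * q - q ^ 2) / (1 + q) ^ 2 := by
      field_simp; ring
    rw [this, abs_div, abs_of_pos (pow_pos h1 2), div_le_iff₀ (pow_pos h1 2)]
    have hp2 : p ^ 2 ≤ k ^ 2 := sq_le_sq' hp'.1 hp'.2
    have hq2 : q ^ 2 ≤ k ^ 2 := sq_le_sq' hq'.1 hq'.2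
    have h2 : 3 * k ≤ 4 * k * (1 + q) ^ 2 := by nlinarith [sq_nonneg q]
    rw [abs_le]; constructor <;> nlinarith [sq_nonneg q, sq_nonneg p]

/-- Hessian of `a * barrier τ` as a quadratic form, in the direction `(e, f)` at `(x, y)`. -/
def barrierHess (τ x y e f : ℝ) : ℝ :=
  τ * ((e ^ 2 + f ^ 2) / (x ^ 2 + y ^ 2) - 2 * (x * e + y * f) ^ 2 / (x ^ 2 + y ^ 2) ^ 2)
    - (e ^ 2 + f ^ 2) / (√(x ^ 2 + y ^ 2)) ^ 3
    + 3 * (x * e + y * f) ^ 2 / (√(x ^ 2 + y ^ 2)) ^ 5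
    + (- 4 * f * (x * e + y * f) / (x ^ 2 + y ^ 2) ^ 2
      - 2 * y * (e ^ 2 + f ^ 2) / (x ^ 2 + y ^ 2) ^ 2
      + 8 * y * (x * e + y * f) ^ 2 / (x ^ 2 + y ^ 2) ^ 3) / 10

/-- Derivative of `barrier τ` at `(x, y)` in the direction `(e, f)`. -/
def barrierGrad (τ x y e f : ℝ) : ℝ :=
  τ * (x * e + y * f) / (x ^ 2 + y ^ 2) - (x * e + y * f) / (√(x ^ 2 + y ^ 2)) ^ 3
    + (f / (x ^ 2 + y ^ 2) - 2 * y * (x * e + y * f) / (x ^ 2 + y ^ 2) ^ 2) / 10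

lemma barrierHess_polar (τ : ℝ) {r u w : ℝ} (hr : 0 < r) (huw : u ^ 2 + w ^ 2 = 1) (e f : ℝ) :
    barrierHess τ (r * u) (r * w) e f = r⁻¹ ^ 2 *
      (τ * (e ^ 2 + f ^ 2 - 2 * (u * e + w * f) ^ 2)
        + r⁻¹ * (- (e ^ 2 + f ^ 2) + 3 * (u * e + w * f) ^ 2
        + (- 4 * f * (u * e + w * f) - 2 * w * (e ^ 2 + f ^ 2)
          + 8 * w * (u * e + w * f) ^ 2) / 10)) := by
  have h : (r * u) ^ 2 + (r * w) ^ 2 = r ^ 2 := by rw [mul_pow, mul_pow, ← mul_add, huw, mul_one]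
  unfold barrierHess
  rw [h, sqrt_sq hr.le]
  field_simp
  ring

lemma barrierHess_operator (τ : ℝ) {r u w : ℝ} (hr : 0 < r) (huw : u ^ 2 + w ^ 2 = 1) (b c : ℝ) :
    barrierHess τ (r * u) (r * w) 1 b + (c - b ^ 2) * barrierHess τ (r * u) (r * w) 0 1
      = r⁻¹ ^ 2 * (r⁻¹ +
        2 * b * (τ * (-2 * u * w) + r⁻¹ * (3 * u * w + (-2 * u + 8 * u * w ^ 2) / 10)) +
        (c - 1) * (τ * (1 - 2 * w ^ 2) +
          r⁻¹ * (- 1 + 3 * w ^ 2 + (- 6 * w + 8 * w ^ 3) / 10))) := by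
  rw [barrierHess_polar τ hr huw, barrierHess_polar τ hr huw]
  have hu2 : u ^ 2 = 1 - w ^ 2 := by linarith
  ring_nf
  simp only [hu2]
  ring

lemma barrier_gradient_bounds {τ x y : ℝ} (hτ : |τ| ≤ 1) (h : 1 ≤ x ^ 2 + y ^ 2) :
    |barrierGrad τ x y 1 0| ≤ 3 * (√(x ^ 2 + y ^ 2))⁻¹ ∧
    |barrierGrad τ x y 0 1| ≤ 3 * (√(x ^ 2 + y ^ 2))⁻¹ := by
  have hr1 : 1 ≤ √(x ^ 2 + y ^ 2) := one_le_sqrt.2 h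
  have hs2 := sq_sqrt (zero_le_one.trans h)
  unfold barrierGrad
  set ρ := x ^ 2 + y ^ 2 with hρ
  set r := √ρ
  have hr : 0 < r := by linarith
  have hi1 : r⁻¹ ≤ 1 := inv_le_one_of_one_le₀ hr1
  have huw : (x / r) ^ 2 + (y / r) ^ 2 = 1 := by field_simp; rw [hs2]
  obtain ⟨-, -, h3, h4⟩ := barrier_cross_bounds hτ (inv_pos.2 hr) hi1 huw
  have e1 : τ * (x * 1 + y * 0) / ρ - (x * 1 + y * 0) / r ^ 3
      + (0 / ρ - 2 * y * (x * 1 + y * 0) / ρ ^ 2) / 10 =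
      (τ * (x / r) - r⁻¹ * (x / r) - 2 * r⁻¹ * (x / r) * (y / r) / 10) * r⁻¹ := by
    rw [← hs2]; field_simp; ring
  have e2 : τ * (x * 0 + y * 1) / ρ - (x * 0 + y * 1) / r ^ 3
      + (1 / ρ - 2 * y * (x * 0 + y * 1) / ρ ^ 2) / 10 =
      (τ * (y / r) - r⁻¹ * (y / r) + r⁻¹ * (1 - 2 * (y / r) ^ 2) / 10) * r⁻¹ := by
    rw [← hs2]; field_simp; ring
  rw [e1, e2, abs_mul, abs_mul, abs_of_pos (inv_pos.2 hr)]
  exact ⟨by gcongr, by gcongr⟩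

lemma exists_polar {x y : ℝ} (h : 1 ≤ x ^ 2 + y ^ 2) :
    ∃ r u w : ℝ, 1 ≤ r ∧ u ^ 2 + w ^ 2 = 1 ∧ x = r * u ∧ y = r * w := by
  have hr1 : 1 ≤ √(x ^ 2 + y ^ 2) := one_le_sqrt.2 h
  have hs2 := sq_sqrt (zero_le_one.trans h)
  have hr : 0 < √(x ^ 2 + y ^ 2) := by linarith
  refine ⟨√(x ^ 2 + y ^ 2), x / √(x ^ 2 + y ^ 2), y / √(x ^ 2 + y ^ 2), hr1, ?_, ?_, ?_⟩
  · rw [div_pow, div_pow, hs2, ← add_div, div_self (by linarith)]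
  · field_simp
  · field_simp

lemma barrier_strict_interior {τ x y p q a : ℝ} (hτ : |τ| ≤ 1) (h : 1 ≤ x ^ 2 + y ^ 2)
    (ha : 0 < a) (ha1 : a ≤ 1 / 1000)
    (hp : |p| = a * |barrierGrad τ x y 1 0|) (hq : |q| = a * |barrierGrad τ x y 0 1|) :
    0 < barrierHess τ x y 1 (p / (1 + q)) +
      ((1 + p ^ 2) / (1 + q) ^ 2 - (p / (1 + q)) ^ 2) * barrierHess τ x y 0 1 := by
  obtain ⟨g1, g2⟩ := barrier_gradient_bounds hτ h
  obtain ⟨r, u, w, hr1, huw, rfl, rfl⟩ := exists_polar h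
  have hr : 0 < r := by linarith
  have hs : √((r * u) ^ 2 + (r * w) ^ 2) = r := by
    rw [mul_pow, mul_pow, ← mul_add, huw, mul_one, sqrt_sq hr.le]
  rw [hs] at g1 g2
  have hi1 : r⁻¹ ≤ 1 := inv_le_one_of_one_le₀ hr1
  have hi0 := inv_pos.2 hr
  have hp1 : |p| ≤ 3 * a * r⁻¹ := by
    rw [hp]; exact (mul_le_mul_of_nonneg_left g1 ha.le).trans_eq (by ring)
  have hq1 : |q| ≤ 3 * a * r⁻¹ := by
    rw [hq]; exact (mul_le_mul_of_nonneg_left g2 ha.le).trans_eq (by ring)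
  obtain ⟨hb, hc⟩ := coefficient_bounds hp1 hq1 (by nlinarith)
  rw [barrierHess_operator τ hr huw]
  obtain ⟨h1, h2, -, -⟩ := barrier_cross_bounds hτ hi0 hi1 huw
  revert h1 h2 hb hc
  generalize τ * (-2 * u * w) + r⁻¹ * (3 * u * w + (-2 * u + 8 * u * w ^ 2) / 10) = X
  generalize τ * (1 - 2 * w ^ 2) + r⁻¹ * (- 1 + 3 * w ^ 2 + (- 6 * w + 8 * w ^ 3) / 10) = Y
  generalize p / (1 + q) = b
  generalize (1 + p ^ 2) / (1 + q) ^ 2 - 1 = c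
  intro hb hc h1 h2
  have t1 : |2 * b * X| ≤ 2 * (2 * (3 * a * r⁻¹)) * 5 := by
    rw [abs_mul, abs_mul, abs_two]
    gcongr
  have t2 : |c * Y| ≤ 4 * (3 * a * r⁻¹) * 9 := by
    rw [abs_mul]
    gcongr
  have t1' := (abs_le.1 t1).1
  have t2' := (abs_le.1 t2).1
  have t3 : a * r⁻¹ ≤ 1 / 1000 * r⁻¹ := by gcongr
  apply mul_pos (pow_pos hi0 2)
  linarith

lemma barrier_strict_boundary {τ x p a : ℝ} (hτ : |τ| ≤ 1) (h : 1 ≤ x ^ 2)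
    (ha : 0 < a) (ha1 : a ≤ 1 / 1000) (hp : |p| = a * |barrierGrad τ x 0 1 0|) :
    √(1 + p ^ 2) - 1 < a * barrierGrad τ x 0 0 1 := by
  have h' : 1 ≤ x ^ 2 + (0 : ℝ) ^ 2 := by simpa using h
  obtain ⟨g1, -⟩ := barrier_gradient_bounds hτ h'
  have h0 : 0 < x ^ 2 := by linarith
  have hs2 := sq_sqrt (zero_le_one.trans h')
  have hr : 0 < √(x ^ 2 + (0 : ℝ) ^ 2) := sqrt_pos.2 (by linarith)
  have e : barrierGrad τ x 0 0 1 = ((√(x ^ 2 + (0 : ℝ) ^ 2))⁻¹) ^ 2 / 10 := by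
    unfold barrierGrad
    rw [inv_pow, hs2]; field_simp; ring
  rw [e]
  set i := (√(x ^ 2 + (0 : ℝ) ^ 2))⁻¹ with hi
  have hi0 : 0 < i := inv_pos.2 hr
  have hp1 : |p| ≤ 3 * a * i := by rw [hp]; nlinarith
  have hp2 : p ^ 2 ≤ (3 * a * i) ^ 2 := by rw [← sq_abs]; gcongr
  have hs : √(1 + p ^ 2) ≤ 1 + p ^ 2 / 2 := by
    apply sqrt_le_iff.2; constructor <;> nlinarith [sq_nonneg p, sq_nonneg (p^2)]
  have : (3 * a * i) ^ 2 / 2 < a * (i ^ 2 / 10) := by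
    have : 0 < a * i ^ 2 := by positivity
    nlinarith
  linarith

lemma nonneg_deriv_of_right_min {f : ℝ → ℝ} {c : ℝ} (h : HasDerivAt f c 0)
    (hm : ∀ᶠ t in nhdsWithin (0 : ℝ) (Ioi 0), f 0 ≤ f t) : 0 ≤ c := by
  have := (hasDerivWithinAt_iff_tendsto_slope' (by simp)).1 (h.hasDerivWithinAt (s := Ioi 0))
  refine ge_of_tendsto this ?_
  filter_upwards [hm, self_mem_nhdsWithin] with t ht ht0
  rw [slope_def_field]
  exact div_nonneg (by linarith) (by simpa using (le_of_lt ht0))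

lemma hasDerivAt_line (x e t : ℝ) : HasDerivAt (fun t => x + t * e) e t := by
  simpa using ((hasDerivAt_id t).mul_const e).const_add x

lemma PlaneSol.hasDerivAt_diff {V P Q R S T : ℝ × ℝ → ℝ} (hs : PlaneSol V P Q R S T)
    (σ τ a : ℝ) {x y e f t : ℝ} (h : (x + t * e, y + t * f) ∈ planeDom) :
    HasDerivAt (fun t => σ * V (x + t * e, y + t * f) - a * barrier τ (x + t * e, y + t * f))
      (σ * (P (x + t * e, y + t * f) * e + Q (x + t * e, y + t * f) * f)
        - a * barrierGrad τ (x + t * e) (y + t * f) e f) t :=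
  ((hasDerivAt_along_curve (hs.dV _ h) (hasDerivAt_line x e t) (hasDerivAt_line y f t)).const_mul
    σ).sub ((hasDerivAt_barrier_line τ (by have := h.2; simp only at this; linarith)).const_mul a)

lemma PlaneSol.hasDerivAt_diff_deriv {V P Q R S T : ℝ × ℝ → ℝ} (hs : PlaneSol V P Q R S T)
    (σ τ a : ℝ) {x y e f : ℝ} (h : (x, y) ∈ planeDom) :
    HasDerivAt (fun t => σ * (P (x + t * e, y + t * f) * e + Q (x + t * e, y + t * f) * f)
        - a * barrierGrad τ (x + t * e) (y + t * f) e f)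
      (σ * (R (x, y) * e ^ 2 + 2 * S (x, y) * e * f + T (x, y) * f ^ 2)
        - a * barrierHess τ x y e f) 0 := by
  have h0 : (x + 0 * e, y + 0 * f) ∈ planeDom := by simpa using h
  have hP := hasDerivAt_along_curve (hs.dP _ h0) (hasDerivAt_line x e 0) (hasDerivAt_line y f 0)
  have hQ := hasDerivAt_along_curve (hs.dQ _ h0) (hasDerivAt_line x e 0) (hasDerivAt_line y f 0)
  have hb := hasDerivAt_barrier_line_deriv τ (x := x) (y := y) (e := e) (f := f)
    (by have := h.2; simp only at this; linarith)
  have key := (((hP.mul_const e).add (hQ.mul_const f)).const_mul σ).sub (hb.const_mul a)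
  refine key.congr_deriv ?_
  simp only [zero_mul, add_zero, barrierHess]
  ring

lemma isCompact_annulus (r₁ r₂ : ℝ) :
    IsCompact {z : ℝ × ℝ | 0 ≤ z.2 ∧ r₁ ≤ z.1 ^ 2 + z.2 ^ 2 ∧ z.1 ^ 2 + z.2 ^ 2 ≤ r₂} := by
  apply Metric.isCompact_of_isClosed_isBounded
  · have h1 : IsClosed {z : ℝ × ℝ | 0 ≤ z.2} := isClosed_le (by fun_prop) (by fun_prop)
    have h2 : IsClosed {z : ℝ × ℝ | r₁ ≤ z.1 ^ 2 + z.2 ^ 2} :=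
      isClosed_le (by fun_prop) (by fun_prop)
    have h3 : IsClosed {z : ℝ × ℝ | z.1 ^ 2 + z.2 ^ 2 ≤ r₂} :=
      isClosed_le (by fun_prop) (by fun_prop)
    exact h1.inter (h2.inter h3)
  · refine (Metric.isBounded_closedBall (x := (0 : ℝ × ℝ)) (r := 1 + r₂)).subset ?_
    rintro ⟨x, y⟩ ⟨-, -, h⟩
    simp only at h
    simp only [mem_closedBall_zero_iff, Prod.norm_def, Real.norm_eq_abs, sup_le_iff, abs_le]
    refine ⟨⟨?_, ?_⟩, ⟨?_, ?_⟩⟩ <;> nlinarith [sq_nonneg (x - 1), sq_nonneg (x + 1),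
      sq_nonneg (y - 1), sq_nonneg (y + 1)]

lemma continuousAt_barrier (τ : ℝ) {z : ℝ × ℝ} (h : 0 < z.1 ^ 2 + z.2 ^ 2) :
    ContinuousAt (barrier τ) z := by
  unfold barrier
  have h1 := h.ne'
  have h2 := (sqrt_pos.2 h).ne'
  fun_prop (disch := assumption)

/-- Comparison from below with a small multiple of the barrier on a half annulus. -/
lemma PlaneSol.comparison {V P Q R S T : ℝ × ℝ → ℝ} (hs : PlaneSol V P Q R S T)
    {σ τ a k ρ₁ ρ₂ : ℝ} (hσ : σ = 1 ∨ σ = -1) (hτ : |τ| ≤ 1) (ha : 0 < a) (ha1 : a ≤ 1 / 1000)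
    (hρ : 1 ≤ ρ₁)
    (h1 : ∀ z : ℝ × ℝ, 0 ≤ z.2 → z.1 ^ 2 + z.2 ^ 2 = ρ₁ → k + a * barrier τ z ≤ σ * V z)
    (h2 : ∀ z : ℝ × ℝ, 0 ≤ z.2 → z.1 ^ 2 + z.2 ^ 2 = ρ₂ → k + a * barrier τ z ≤ σ * V z)
    {z : ℝ × ℝ} (hz : 0 ≤ z.2) (hz1 : ρ₁ ≤ z.1 ^ 2 + z.2 ^ 2) (hz2 : z.1 ^ 2 + z.2 ^ 2 ≤ ρ₂) :
    k + a * barrier τ z ≤ σ * V z := by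
  set D := {z : ℝ × ℝ | 0 ≤ z.2 ∧ ρ₁ ≤ z.1 ^ 2 + z.2 ^ 2 ∧ z.1 ^ 2 + z.2 ^ 2 ≤ ρ₂} with hD
  have hDH : D ⊆ planeDom := fun z hz => ⟨hz.1, hρ.trans hz.2.1⟩
  have hcont : ContinuousOn (fun z => σ * V z - a * barrier τ z) D := fun z hz =>
    ((((hs.dV z (hDH hz)).continuousAt).const_mul σ).sub
      ((continuousAt_barrier τ (by have := (hDH hz).2; linarith)).const_mul a)).continuousWithinAt
  obtain ⟨⟨x, y⟩, hmem, hmin⟩ := (isCompact_annulus ρ₁ ρ₂).exists_isMinOn ⟨z, hz, hz1, hz2⟩ hcont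
  by_contra! hlt
  have hzle := hmin (show z ∈ D from ⟨hz, hz1, hz2⟩)
  simp only [mem_ofPred_eq] at hzle
  have hlt0 : σ * V (x, y) - a * barrier τ (x, y) < k := by linarith
  have hH := hDH hmem
  obtain ⟨hy, hm1, hm2⟩ := hmem
  simp only at hy hm1 hm2
  have hm1' : ρ₁ < x ^ 2 + y ^ 2 := lt_of_le_of_ne hm1 fun h => by
    have := h1 (x, y) hy h.symm; linarith
  have hm2' : x ^ 2 + y ^ 2 < ρ₂ := lt_of_le_of_ne hm2 fun h => by
    have := h2 (x, y) hy h; linarith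
  have hσσ : σ * σ = 1 := by rcases hσ with rfl | rfl <;> norm_num
  have hσabs : |σ| = 1 := by rcases hσ with rfl | rfl <;> norm_num
  have hrad : ∀ e f : ℝ, ∀ᶠ t in nhds (0 : ℝ), ρ₁ ≤ (x + t * e) ^ 2 + (y + t * f) ^ 2 ∧
      (x + t * e) ^ 2 + (y + t * f) ^ 2 ≤ ρ₂ := fun e f => by
    have hc : ContinuousAt (fun t : ℝ => (x + t * e) ^ 2 + (y + t * f) ^ 2) 0 := by fun_prop
    have e1 := hc.tendsto.eventually_const_lt (u := ρ₁) (by simpa using hm1')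
    have e2 := hc.tendsto.eventually_lt_const (u := ρ₂) (by simpa using hm2')
    filter_upwards [e1, e2] with t a b using ⟨a.le, b.le⟩
  have hfst : ∀ e f : ℝ, (∀ᶠ t in nhds (0 : ℝ), 0 ≤ y + t * f) →
      IsLocalMin (fun t => σ * V (x + t * e, y + t * f) - a * barrier τ (x + t * e, y + t * f)) 0 ∧
      σ * (P (x, y) * e + Q (x, y) * f) = a * barrierGrad τ x y e f := fun e f hev => by
    have hlm : IsLocalMin
        (fun t => σ * V (x + t * e, y + t * f) - a * barrier τ (x + t * e, y + t * f)) 0 := by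
      filter_upwards [hev, hrad e f] with t ht htr
      have := hmin (show (x + t * e, y + t * f) ∈ D from ⟨ht, htr.1, htr.2⟩)
      simpa using this
    refine ⟨hlm, ?_⟩
    have hd := hs.hasDerivAt_diff σ τ a (x := x) (y := y) (e := e) (f := f) (t := 0)
      (by simpa using hH)
    have := hlm.hasDerivAt_eq_zero hd
    simp only [zero_mul, add_zero] at this
    linarith
  have hbP : σ * P (x, y) = a * barrierGrad τ x y 1 0 := by
    have := (hfst 1 0 (by simpa using hy)).2
    simpa using this
  have hPabs : |P (x, y)| = a * |barrierGrad τ x y 1 0| := by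
    have := congrArg abs hbP
    rwa [abs_mul, abs_mul, hσabs, one_mul, abs_of_pos ha] at this
  rcases hy.eq_or_lt with hy0 | hy0
  · subst hy0
    have hd := hs.hasDerivAt_diff σ τ a (x := x) (y := 0) (e := 0) (f := 1) (t := 0)
      (by simpa using hH)
    have hnn := nonneg_deriv_of_right_min hd (by
      filter_upwards [nhdsWithin_le_nhds (hrad 0 1), self_mem_nhdsWithin] with t ht ht0
      have := hmin (show (x + t * 0, 0 + t * 1) ∈ D from
        ⟨by simpa using le_of_lt ht0, ht.1, ht.2⟩)
      simpa using this)
    simp only [add_zero, mul_zero, mul_one, zero_add] at hnn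
    have hb := hs.bc (x, 0) hH rfl
    have hx1 : 1 ≤ x ^ 2 := by simpa using hH.2
    have hstrict := barrier_strict_boundary hτ hx1 ha ha1 hPabs
    have hN : 0 ≤ √(1 + P (x, 0) ^ 2) - 1 := by
      have : 1 ≤ √(1 + P (x, 0) ^ 2) := one_le_sqrt.2 (by nlinarith [sq_nonneg (P (x, 0))])
      linarith
    rw [hb] at hnn
    rcases hσ with rfl | rfl <;> linarith
  · have hev : ∀ f : ℝ, ∀ᶠ t in nhds (0 : ℝ), 0 ≤ y + t * f := fun f => by
      have hc : ContinuousAt (fun t : ℝ => y + t * f) 0 := by fun_prop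
      exact (hc.tendsto.eventually_const_lt (u := 0) (by simpa using hy0)).mono fun t h => h.le
    have hbQ : σ * Q (x, y) = a * barrierGrad τ x y 0 1 := by
      have := (hfst 0 1 (hev 1)).2
      simpa using this
    have hQabs : |Q (x, y)| = a * |barrierGrad τ x y 0 1| := by
      have := congrArg abs hbQ
      rwa [abs_mul, abs_mul, hσabs, one_mul, abs_of_pos ha] at this
    have hsnd : ∀ e f : ℝ, 0 ≤ σ * (R (x, y) * e ^ 2 + 2 * S (x, y) * e * f + T (x, y) * f ^ 2)
        - a * barrierHess τ x y e f := fun e f => by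
      refine second_deriv_nonneg_of_isLocalMin ?_ (hs.hasDerivAt_diff_deriv σ τ a hH)
        (hfst e f (hev f)).1
      filter_upwards [hev f, hrad e f] with t ht htr
      exact hs.hasDerivAt_diff σ τ a ⟨ht, hρ.trans htr.1⟩
    have hpos := barrier_strict_interior hτ hH.2 ha ha1 hPabs hQabs
    have hpde := hs.pde (x, y) hH hy0
    have hq1 : 0 < 1 + Q (x, y) := by
      obtain ⟨-, g2⟩ := barrier_gradient_bounds hτ hH.2
      have : (√((x, y).1 ^ 2 + (x, y).2 ^ 2))⁻¹ ≤ 1 :=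
        inv_le_one_of_one_le₀ (one_le_sqrt.2 hH.2)
      simp only at this g2
      have h3 : |Q (x, y)| ≤ 1 / 2 := by rw [hQabs]; nlinarith [abs_nonneg (barrierGrad τ x y 0 1)]
      linarith [(abs_le.1 h3).1]
    have s1 := hsnd 1 (P (x, y) / (1 + Q (x, y)))
    have s2 := hsnd 0 1
    have hdet : 0 ≤ (1 + P (x, y) ^ 2) / (1 + Q (x, y)) ^ 2 - (P (x, y) / (1 + Q (x, y))) ^ 2 := by
      rw [div_pow, ← sub_div]; apply div_nonneg _ (by positivity); linarith
    have s3 := mul_nonneg hdet s2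
    have s4 := mul_pos ha hpos
    have s5 := congrArg (fun r => σ * r) hpde
    simp only [mul_zero] at s5
    nlinarith

/-- The pair generating a conservation law of the hodograph equation. -/
lemma exists_flux_profile {σ : ℝ} (hσ : σ = 1 ∨ σ = -1) :
    ∃ f g : ℝ → ℝ, ∃ δ : ℝ, 0 < δ ∧ δ ≤ 1 / 10 ∧
      (∀ q, |q - 1| ≤ δ → HasDerivAt f (2 * (f q / q - g q)) q ∧ HasDerivAt g (f q / q ^ 2) q ∧
        1 / 2 ≤ f q ∧ f q ≤ 2 ∧ |g q| ≤ 2 ∧ 1 / 2 ≤ f q / q ^ 2 ∧ f q / q ^ 2 ≤ 2) ∧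
      (∀ q, 1 ≤ q → q ≤ 1 + δ → σ * (q ^ 2 * g q - g 1) ≤ 0) := by
  have hσσ : σ * σ = 1 := by rcases hσ with rfl | rfl <;> norm_num
  set ω : ℝ := √7 / 2 with hω
  have hω2 : ω ^ 2 = 7 / 4 := by rw [hω, div_pow, sq_sqrt (by norm_num)]; norm_num
  have hω0 : ω ≠ 0 := by rw [hω]; positivity
  set β : ℝ := (3 / 2 + σ) / ω with hβ
  have hβω : β * ω = 3 / 2 + σ := by rw [hβ]; field_simp
  set f : ℝ → ℝ := fun q => exp (3 / 2 * log q) * (cos (ω * log q) + β * sin (ω * log q)) with hf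
  set g : ℝ → ℝ := fun q => exp (1 / 2 * log q) *
    ((1 / 4 - β * ω / 2) * cos (ω * log q) + (β / 4 + ω / 2) * sin (ω * log q)) with hg
  have hexp : ∀ q : ℝ, 0 < q → exp (3 / 2 * log q) = exp (1 / 2 * log q) * q := fun q hq => by
    rw [show 3 / 2 * log q = 1 / 2 * log q + log q by ring, exp_add, exp_log hq]
  have hdf : ∀ q, 0 < q → HasDerivAt f (2 * (f q / q - g q)) q := fun q hq => by
    have hl := hasDerivAt_log hq.ne'
    have key := ((hl.const_mul (3 / 2)).exp).mul
      (((hl.const_mul ω).cos).add (((hl.const_mul ω).sin).const_mul β))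
    refine key.congr_deriv ?_
    simp only [hf, hg, hexp q hq, Pi.add_apply]
    field_simp
    ring
  have hdg : ∀ q, 0 < q → HasDerivAt g (f q / q ^ 2) q := fun q hq => by
    have hl := hasDerivAt_log hq.ne'
    have key := ((hl.const_mul (1 / 2)).exp).mul
      ((((hl.const_mul ω).cos).const_mul (1 / 4 - β * ω / 2)).add
        (((hl.const_mul ω).sin).const_mul (β / 4 + ω / 2)))
    refine key.congr_deriv ?_
    simp only [hf, hexp q hq, Pi.add_apply]
    field_simp
    ring_nf
    rw [hω2]
    ring
  have hf1 : f 1 = 1 := by simp [hf]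
  have hg1 : g 1 = -(1 + σ) / 2 := by simp only [hg, log_one]; simp; linarith
  have cf : ContinuousAt f 1 := (hdf 1 one_pos).continuousAt
  have cg : ContinuousAt g 1 := (hdg 1 one_pos).continuousAt
  have cfq : ContinuousAt (fun q => f q / q ^ 2) 1 := by fun_prop (disch := norm_num)
  have ch : ContinuousAt (fun q => σ * (2 * q * g q + f q)) 1 := by fun_prop
  have hg2 : |g 1| < 2 := by rw [hg1]; rcases hσ with rfl | rfl <;> norm_num
  have ev : ∀ᶠ q in nhds (1 : ℝ), 1 / 2 < f q ∧ f q < 2 ∧ |g q| < 2 ∧ 1 / 2 < f q / q ^ 2 ∧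
      f q / q ^ 2 < 2 ∧ σ * (2 * q * g q + f q) < 0 := by
    filter_upwards [cf.tendsto.eventually_const_lt (u := 1 / 2) (by rw [hf1]; norm_num),
      cf.tendsto.eventually_lt_const (u := 2) (by rw [hf1]; norm_num),
      cg.abs.tendsto.eventually_lt_const (u := 2) hg2,
      cfq.tendsto.eventually_const_lt (u := 1 / 2) (by rw [hf1]; norm_num),
      cfq.tendsto.eventually_lt_const (u := 2) (by rw [hf1]; norm_num),
      ch.tendsto.eventually_lt_const (u := 0) (by rw [hf1, hg1]; nlinarith)] with q a b c d e k
    exact ⟨a, b, c, d, e, k⟩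
  obtain ⟨ε, hε, hball⟩ := Metric.eventually_nhds_iff.1 ev
  have hmin : ∀ q, |q - 1| ≤ min (ε / 2) (1 / 10) → 0 < q ∧ dist q 1 < ε := fun q hq => by
    have h1 := hq.trans (min_le_left _ _)
    have h2 := hq.trans (min_le_right _ _)
    exact ⟨by linarith [(abs_le.1 h2).1], by rw [Real.dist_eq]; linarith⟩
  refine ⟨f, g, min (ε / 2) (1 / 10), by positivity, min_le_right _ _, fun q hq => ?_,
    fun q hq1 hq2 => ?_⟩
  · obtain ⟨h0, hd⟩ := hmin q hq
    obtain ⟨a, b, c, d, e, -⟩ := hball hd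
    exact ⟨hdf q h0, hdg q h0, a.le, b.le, c.le, d.le, e.le⟩
  · have hin : ∀ t ∈ Icc 1 q, 0 < t ∧ dist t 1 < ε := fun t ht => by
      apply hmin
      rw [abs_of_nonneg (by linarith [ht.1])]
      linarith [ht.2]
    have hd : ∀ t ∈ Icc 1 q, HasDerivAt (fun t => σ * (t ^ 2 * g t - g 1))
        (σ * (2 * t * g t + f t)) t := fun t ht => by
      have h0 := (hin t ht).1
      have key := ((((hasDerivAt_id t).pow 2).mul (hdg t h0)).sub_const (g 1)).const_mul σ
      refine key.congr_deriv ?_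
      simp
      field_simp
      exact Or.inl trivial
    have hanti : AntitoneOn (fun t => σ * (t ^ 2 * g t - g 1)) (Icc 1 q) := by
      apply antitoneOn_of_deriv_nonpos (convex_Icc _ _)
      · exact fun t ht => (hd t ht).continuousAt.continuousWithinAt
      · intro t ht
        exact (hd t (interior_subset ht)).differentiableAt.differentiableWithinAt
      · intro t ht
        rw [(hd t (interior_subset ht)).deriv]
        exact (hball (hin t (interior_subset ht)).2).2.2.2.2.2.le
    have := hanti (left_mem_Icc.2 hq1) (right_mem_Icc.2 hq1) hq1
    simpa using this

/-- A conservation law `∂₁ F₁(∇v) + ∂₂ F₂(∇v) = 0` for the hodograph equation, with signed flux on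
the boundary curve. -/
structure IsFlux (σ δ : ℝ) (F₁ F₂ : ℝ × ℝ → ℝ) (F₁p F₁q F₂p F₂q : ℝ × ℝ → ℝ) : Prop where
  d₁ : ∀ z : ℝ × ℝ, |z.1| ≤ δ → |z.2| ≤ δ → HasFDerivAt F₁
    (F₁p z • ContinuousLinearMap.fst ℝ ℝ ℝ + F₁q z • ContinuousLinearMap.snd ℝ ℝ ℝ) z
  d₂ : ∀ z : ℝ × ℝ, |z.1| ≤ δ → |z.2| ≤ δ → HasFDerivAt F₂
    (F₂p z • ContinuousLinearMap.fst ℝ ℝ ℝ + F₂q z • ContinuousLinearMap.snd ℝ ℝ ℝ) z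
  c₁p : ∀ z : ℝ × ℝ, |z.1| ≤ δ → |z.2| ≤ δ → ContinuousAt F₁p z
  c₁q : ∀ z : ℝ × ℝ, |z.1| ≤ δ → |z.2| ≤ δ → ContinuousAt F₁q z
  c₂p : ∀ z : ℝ × ℝ, |z.1| ≤ δ → |z.2| ≤ δ → ContinuousAt F₂p z
  c₂q : ∀ z : ℝ × ℝ, |z.1| ≤ δ → |z.2| ≤ δ → ContinuousAt F₂q z
  conservation : ∀ z : ℝ × ℝ, |z.1| ≤ δ → |z.2| ≤ δ → ∀ R S T : ℝ,
    R + 2 * (z.1 / (1 + z.2)) * S + (1 + z.1 ^ 2) / (1 + z.2) ^ 2 * T = 0 →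
    F₁p z * R + F₁q z * S + (F₂p z * S + F₂q z * T) = 0
  elliptic : ∀ z : ℝ × ℝ, |z.1| ≤ δ → |z.2| ≤ δ →
    (z.1 ^ 2 + z.2 ^ 2) / 4 ≤ F₁ z * z.1 + F₂ z * z.2
  growth : ∀ z : ℝ × ℝ, |z.1| ≤ δ → |z.2| ≤ δ →
    F₁ z ^ 2 + F₂ z ^ 2 ≤ 36 * (z.1 ^ 2 + z.2 ^ 2)
  boundary : ∀ z : ℝ × ℝ, |z.1| ≤ δ → |z.2| ≤ δ → z.2 = √(1 + z.1 ^ 2) - 1 → σ * F₂ z ≤ 0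

lemma exists_isFlux {σ : ℝ} (hσ : σ = 1 ∨ σ = -1) :
    ∃ δ : ℝ, 0 < δ ∧ δ ≤ 1 / 10 ∧ ∃ F₁ F₂ F₁p F₁q F₂p F₂q : ℝ × ℝ → ℝ,
      IsFlux σ δ F₁ F₂ F₁p F₁q F₂p F₂q := by
  obtain ⟨f, g, δ, hδ, hδ1, hfg, hbd⟩ := exists_flux_profile hσ
  have hsh : ∀ q : ℝ, |q| ≤ δ → |1 + q - 1| ≤ δ := fun q hq => by simpa using hq
  have hdf : ∀ z : ℝ × ℝ, |z.2| ≤ δ → HasFDerivAt (fun z : ℝ × ℝ => f (1 + z.2))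
      ((2 * (f (1 + z.2) / (1 + z.2) - g (1 + z.2))) • ContinuousLinearMap.snd ℝ ℝ ℝ) z :=
    fun z hz => by
      have := (hfg _ (hsh _ hz)).1.comp_hasFDerivAt z ((hasFDerivAt_snd (𝕜 := ℝ) (E := ℝ) (F := ℝ) (p := z)).const_add (1 : ℝ))
      simpa [Function.comp_def] using this
  have hdg : ∀ z : ℝ × ℝ, |z.2| ≤ δ → HasFDerivAt (fun z : ℝ × ℝ => g (1 + z.2))
      ((f (1 + z.2) / (1 + z.2) ^ 2) • ContinuousLinearMap.snd ℝ ℝ ℝ) z :=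
    fun z hz => by
      have := (hfg _ (hsh _ hz)).2.1.comp_hasFDerivAt z ((hasFDerivAt_snd (𝕜 := ℝ) (E := ℝ) (F := ℝ) (p := z)).const_add (1 : ℝ))
      simpa [Function.comp_def] using this
  have hne : ∀ z : ℝ × ℝ, |z.2| ≤ δ → 0 < 1 + z.2 := fun z hz => by
    linarith [(abs_le.1 hz).1]
  have hslope : ∀ q : ℝ, |q| ≤ δ → ∃ k : ℝ, 1 / 2 ≤ k ∧ k ≤ 2 ∧ g (1 + q) - g 1 = k * q := by
    intro q hq
    have hq' := abs_le.1 hq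
    have hd : ∀ t : ℝ, |t - 1| ≤ δ → HasDerivAt g (f t / t ^ 2) t := fun t ht => (hfg t ht).2.1
    rcases lt_trichotomy q 0 with h | rfl | h
    · have hb : ∀ t ∈ Icc (1 + q) 1, |t - 1| ≤ δ := fun t ht => by
        rw [abs_le]; constructor <;> linarith [ht.1, ht.2]
      obtain ⟨c, hc, he⟩ := exists_hasDerivAt_eq_slope g (fun t => f t / t ^ 2)
        (show 1 + q < 1 by linarith)
        (fun t ht => (hd t (hb t ht)).continuousAt.continuousWithinAt)
        (fun t ht => hd t (hb t (Ioo_subset_Icc_self ht)))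
      have := hfg c (hb c (Ioo_subset_Icc_self hc))
      refine ⟨f c / c ^ 2, this.2.2.2.2.2.1, this.2.2.2.2.2.2, ?_⟩
      rw [he]
      have : 1 - (1 + q) ≠ 0 := by linarith
      field_simp
      ring
    · exact ⟨1, by norm_num, by norm_num, by simp⟩
    · have hb : ∀ t ∈ Icc 1 (1 + q), |t - 1| ≤ δ := fun t ht => by
        rw [abs_le]; constructor <;> linarith [ht.1, ht.2]
      obtain ⟨c, hc, he⟩ := exists_hasDerivAt_eq_slope g (fun t => f t / t ^ 2)
        (show 1 < 1 + q by linarith)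
        (fun t ht => (hd t (hb t ht)).continuousAt.continuousWithinAt)
        (fun t ht => hd t (hb t (Ioo_subset_Icc_self ht)))
      have := hfg c (hb c (Ioo_subset_Icc_self hc))
      refine ⟨f c / c ^ 2, this.2.2.2.2.2.1, this.2.2.2.2.2.2, ?_⟩
      rw [he, show 1 + q - 1 = q by ring]
      field_simp
  refine ⟨δ, hδ, hδ1, fun z => z.1 * f (1 + z.2), fun z => (1 + z.1 ^ 2) * g (1 + z.2) - g 1,
    fun z => f (1 + z.2), fun z => z.1 * (2 * (f (1 + z.2) / (1 + z.2) - g (1 + z.2))),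
    fun z => 2 * z.1 * g (1 + z.2), fun z => (1 + z.1 ^ 2) * (f (1 + z.2) / (1 + z.2) ^ 2),
    ?_, ?_, ?_, ?_, ?_, ?_, ?_, ?_, ?_, ?_⟩
  · intro z _ h2
    refine ((hasFDerivAt_fst (𝕜 := ℝ)).mul (hdf z h2)).congr_fderiv ?_
    ext <;> simp
  · intro z _ h2
    have := ((((hasFDerivAt_fst (𝕜 := ℝ) (p := z)).pow 2).const_add 1).mul (hdg z h2)).sub_const (g 1)
    refine this.congr_fderiv ?_
    ext <;> simp; ring
  · intro z _ h2
    exact (hdf z h2).continuousAt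
  · intro z _ h2
    have h1 := (hdf z h2).continuousAt
    have h3 := (hdg z h2).continuousAt
    exact continuousAt_fst.mul (((h1.div (by fun_prop) (hne z h2).ne').sub h3).const_mul 2)
  · intro z _ h2
    exact (continuousAt_fst.const_mul 2).mul (hdg z h2).continuousAt
  · intro z _ h2
    have h1 := (hdf z h2).continuousAt
    exact ContinuousAt.mul (by fun_prop) (h1.div (by fun_prop) (pow_ne_zero 2 (hne z h2).ne'))
  · intro z _ h2 R S T h
    have := (hne z h2).ne'
    calc _ = f (1 + z.2) *
        (R + 2 * (z.1 / (1 + z.2)) * S + (1 + z.1 ^ 2) / (1 + z.2) ^ 2 * T) := by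
          field_simp; ring
      _ = 0 := by rw [h, mul_zero]
  all_goals
    rintro ⟨p, q⟩ h1 h2
    simp only at h1 h2 ⊢
    obtain ⟨-, -, f1, f2, g1, -, -⟩ := hfg _ (hsh _ h2)
  · obtain ⟨k, k1, k2, hk⟩ := hslope q h2
    rw [show (1 + p ^ 2) * g (1 + q) - g 1 = k * q + p ^ 2 * g (1 + q) by linarith]
    have e1 : |g (1 + q) * q| ≤ 2 * (1 / 10) := by
      rw [abs_mul]; exact mul_le_mul g1 (h2.trans hδ1) (abs_nonneg _) (by norm_num)
    nlinarith [(abs_le.1 e1).1, sq_nonneg p, sq_nonneg q]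
  · obtain ⟨k, k1, k2, hk⟩ := hslope q h2
    rw [show (1 + p ^ 2) * g (1 + q) - g 1 = k * q + p ^ 2 * g (1 + q) by linarith]
    have e1 : (p * g (1 + q)) ^ 2 ≤ 1 := by
      rw [sq_le_one_iff_abs_le_one, abs_mul]
      nlinarith [abs_nonneg p, abs_nonneg (g (1 + q))]
    have e2 : f (1 + q) ^ 2 ≤ 4 := by nlinarith
    have e3 : k ^ 2 ≤ 4 := by nlinarith
    have e4 := mul_le_mul_of_nonneg_left e1 (sq_nonneg p)
    have e5 := mul_le_mul_of_nonneg_left e2 (sq_nonneg p)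
    have e6 := mul_le_mul_of_nonneg_left e3 (sq_nonneg q)
    nlinarith [sq_nonneg (k * q - p ^ 2 * g (1 + q)), sq_nonneg p, sq_nonneg q]
  · intro hq
    have h0 : 0 ≤ q := by
      rw [hq, sub_nonneg]; exact one_le_sqrt.2 (by nlinarith [sq_nonneg p])
    have hq2 : (1 + q) ^ 2 = 1 + p ^ 2 := by
      rw [hq]; simpa using sq_sqrt (show 0 ≤ 1 + p ^ 2 by positivity)
    have := hbd (1 + q) (by linarith) (by linarith [(abs_le.1 h2).2])
    rwa [hq2] at this

/-- A differential inequality that forces the dissipation `E` to be small somewhere. -/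
lemma exists_le_of_dissipation {J J' E : ℝ → ℝ} {a : ℝ}
    (hJ : ∀ s ∈ Ioo a (a + 1 / 2), HasDerivAt J (J' s) s)
    (hJ' : ∀ s ∈ Ioo a (a + 1 / 2), J' s ≤ -(E s / 4))
    (hE : ∀ s ∈ Ioo a (a + 1 / 2), J s ^ 2 ≤ 120 * E s) :
    ∃ s ∈ Ioo a (a + 1 / 2), E s ≤ 4000000 := by
  by_contra! h
  have hsub : Icc (a + 1 / 8) (a + 3 / 8) ⊆ Ioo a (a + 1 / 2) := fun t ht =>
    ⟨by linarith [ht.1], by linarith [ht.2]⟩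
  set G : ℝ → ℝ := fun s => arctan (J s / 20000) + 20 * s with hG
  have hd : ∀ s ∈ Ioo a (a + 1 / 2),
      HasDerivAt G (1 / (1 + (J s / 20000) ^ 2) * (J' s / 20000) + 20) s := fun s hs => by
    refine ((((hJ s hs).div_const 20000).arctan).add
      ((hasDerivAt_id s).const_mul 20)).congr_deriv ?_
    simp
  have hanti : AntitoneOn G (Icc (a + 1 / 8) (a + 3 / 8)) := by
    apply antitoneOn_of_deriv_nonpos (convex_Icc _ _)
    · exact fun t ht => (hd t (hsub ht)).continuousAt.continuousWithinAt
    · exact fun t ht =>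
        (hd t (hsub (interior_subset ht))).differentiableAt.differentiableWithinAt
    · intro t ht
      have ht' := hsub (interior_subset ht)
      rw [(hd t ht').deriv]
      have h1 := hJ' t ht'
      have h2 := hE t ht'
      have h3 := h t ht'
      have h4 : J' t / 20000 ≤ -20 * (1 + (J t / 20000) ^ 2) := by
        rw [div_pow]; norm_num; linarith
      have h5 : 0 < 1 + (J t / 20000) ^ 2 := by positivity
      have := mul_le_mul_of_nonneg_left h4 (one_div_pos.2 h5).le
      have h6 : 1 / (1 + (J t / 20000) ^ 2) * (-20 * (1 + (J t / 20000) ^ 2)) = -20 := by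
        field_simp
      linarith
  have := hanti (left_mem_Icc.2 (by linarith)) (right_mem_Icc.2 (by linarith)) (by linarith)
  simp only [hG] at this
  have h1 := arctan_lt_pi_div_two (J (a + 1 / 8) / 20000)
  have h2 := neg_pi_div_two_lt_arctan (J (a + 3 / 8) / 20000)
  linarith [pi_lt_four]

/-- Logarithmic polar coordinates. -/
def polarPt (s θ : ℝ) : ℝ × ℝ := (exp s * cos θ, exp s * sin θ)

lemma polarPt_sq (s θ : ℝ) : (polarPt s θ).1 ^ 2 + (polarPt s θ).2 ^ 2 = exp s ^ 2 := by
  simp only [polarPt]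
  linear_combination exp s ^ 2 * sin_sq_add_cos_sq θ

lemma polarPt_mem {s θ : ℝ} (hs : 0 ≤ s) (hθ : θ ∈ Icc 0 π) : polarPt s θ ∈ planeDom := by
  refine ⟨mul_nonneg (exp_pos s).le (sin_nonneg_of_mem_Icc hθ), ?_⟩
  rw [polarPt_sq]
  exact one_le_pow₀ (one_le_exp hs)

lemma continuous_polarPt : Continuous fun x : ℝ × ℝ => polarPt x.1 x.2 := by
  unfold polarPt; fun_prop

lemma hasDerivAt_polarPt_left {V : ℝ × ℝ → ℝ} {p q s θ : ℝ}
    (hV : HasFDerivAt V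
      (p • ContinuousLinearMap.fst ℝ ℝ ℝ + q • ContinuousLinearMap.snd ℝ ℝ ℝ) (polarPt s θ)) :
    HasDerivAt (fun t => V (polarPt t θ)) (p * (polarPt s θ).1 + q * (polarPt s θ).2) s :=
  hasDerivAt_along_curve hV ((hasDerivAt_exp s).mul_const _) ((hasDerivAt_exp s).mul_const _)

lemma hasDerivAt_polarPt_right {V : ℝ × ℝ → ℝ} {p q s θ : ℝ}
    (hV : HasFDerivAt V
      (p • ContinuousLinearMap.fst ℝ ℝ ℝ + q • ContinuousLinearMap.snd ℝ ℝ ℝ) (polarPt s θ)) :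
    HasDerivAt (fun t => V (polarPt s t)) (p * -(polarPt s θ).2 + q * (polarPt s θ).1) θ := by
  refine (hasDerivAt_along_curve hV ((hasDerivAt_cos θ).const_mul (exp s))
    ((hasDerivAt_sin θ).const_mul (exp s))).congr_deriv ?_
  simp [polarPt]

lemma continuousOn_polarPt_right {f : ℝ × ℝ → ℝ} (hf : ContinuousOn f planeDom) {s : ℝ}
    (hs : 0 ≤ s) : ContinuousOn (fun θ => f (polarPt s θ)) (Icc 0 π) :=
  hf.comp ((continuous_polarPt.comp (Continuous.prodMk_right s)).continuousOn)
    fun _ hθ => polarPt_mem hs hθ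

lemma intervalIntegrable_polarPt {f : ℝ × ℝ → ℝ} (hf : ContinuousOn f planeDom) {s : ℝ}
    (hs : 0 ≤ s) : IntervalIntegrable (fun θ => f (polarPt s θ)) volume 0 π :=
  (continuousOn_polarPt_right hf hs).intervalIntegrable_of_Icc pi_pos.le

lemma hasDerivAt_integral_polarPt {A A' : ℝ × ℝ → ℝ}
    (hA : ∀ s θ, 0 ≤ s → θ ∈ Icc 0 π →
      HasDerivAt (fun t => A (polarPt t θ)) (A' (polarPt s θ)) s)
    (cA : ContinuousOn A planeDom) (cA' : ContinuousOn A' planeDom) {s : ℝ} (hs : 0 < s) :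
    HasDerivAt (fun t => ∫ θ in (0 : ℝ)..π, A (polarPt t θ))
      (∫ θ in (0 : ℝ)..π, A' (polarPt s θ)) s := by
  have hK : IsCompact (Icc 0 (2 * s) ×ˢ Icc 0 π) := isCompact_Icc.prod isCompact_Icc
  obtain ⟨M, hM⟩ := hK.exists_bound_of_continuousOn (f := fun x : ℝ × ℝ => A' (polarPt x.1 x.2))
    (cA'.comp continuous_polarPt.continuousOn fun x hx => polarPt_mem hx.1.1 hx.2)
  have hmem : Icc 0 (2 * s) ∈ nhds s := Icc_mem_nhds hs (by linarith)
  have hsub : uIoc 0 π ⊆ Icc 0 π := by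
    rw [uIoc_of_le pi_pos.le]; exact Ioc_subset_Icc_self
  refine (intervalIntegral.hasDerivAt_integral_of_dominated_loc_of_deriv_le (bound := fun _ => M)
    (F := fun t θ => A (polarPt t θ)) (F' := fun t θ => A' (polarPt t θ))
    hmem ?_ (intervalIntegrable_polarPt cA hs.le) ?_ ?_ ?_ ?_).2
  · filter_upwards [hmem] with t ht
    exact ((continuousOn_polarPt_right cA ht.1).mono hsub).aestronglyMeasurable
      measurableSet_uIoc
  · exact ((continuousOn_polarPt_right cA' hs.le).mono hsub).aestronglyMeasurable
      measurableSet_uIoc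
  · exact ae_of_all _ fun θ hθ t ht => hM (t, θ) ⟨ht, hsub hθ⟩
  · exact intervalIntegrable_const
  · exact ae_of_all _ fun θ hθ t ht => hA t θ ht.1 (hsub hθ)

/-- A positive function with a divergence-free elliptic flux has small logarithmic energy on some
half circle. -/
lemma exists_small_energy {W Wx Wy X Xx Xy Y Yx Yy : ℝ × ℝ → ℝ}
    (dW : ∀ z ∈ planeDom, HasFDerivAt W
      (Wx z • ContinuousLinearMap.fst ℝ ℝ ℝ + Wy z • ContinuousLinearMap.snd ℝ ℝ ℝ) z)
    (dX : ∀ z ∈ planeDom, HasFDerivAt X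
      (Xx z • ContinuousLinearMap.fst ℝ ℝ ℝ + Xy z • ContinuousLinearMap.snd ℝ ℝ ℝ) z)
    (dY : ∀ z ∈ planeDom, HasFDerivAt Y
      (Yx z • ContinuousLinearMap.fst ℝ ℝ ℝ + Yy z • ContinuousLinearMap.snd ℝ ℝ ℝ) z)
    (cWx : ContinuousOn Wx planeDom) (cWy : ContinuousOn Wy planeDom)
    (cXx : ContinuousOn Xx planeDom) (cXy : ContinuousOn Xy planeDom)
    (cYx : ContinuousOn Yx planeDom) (cYy : ContinuousOn Yy planeDom)
    (hW : ∀ z ∈ planeDom, 0 < W z)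
    (hdiv : ∀ z ∈ planeDom, 0 < z.2 → Xx z + Yy z = 0)
    (hell : ∀ z ∈ planeDom, (Wx z ^ 2 + Wy z ^ 2) / 4 ≤ X z * Wx z + Y z * Wy z)
    (hgr : ∀ z ∈ planeDom, X z ^ 2 + Y z ^ 2 ≤ 36 * (Wx z ^ 2 + Wy z ^ 2))
    (hbd : ∀ z ∈ planeDom, z.2 = 0 → Y z ≤ 0) {a : ℝ} (ha : 0 ≤ a) :
    ∃ s ∈ Ioo a (a + 1 / 2), ∫ θ in (0 : ℝ)..π, (fun z : ℝ × ℝ =>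
      (z.1 ^ 2 + z.2 ^ 2) * (Wx z ^ 2 + Wy z ^ 2) / W z ^ 2) (polarPt s θ) ≤ 4000000 := by
  have cW : ContinuousOn W planeDom := fun z hz => (dW z hz).continuousAt.continuousWithinAt
  have cX : ContinuousOn X planeDom := fun z hz => (dX z hz).continuousAt.continuousWithinAt
  have cY : ContinuousOn Y planeDom := fun z hz => (dY z hz).continuousAt.continuousWithinAt
  have hne : ∀ z ∈ planeDom, W z ≠ 0 := fun z hz => (hW z hz).ne'
  have hne2 : ∀ z ∈ planeDom, W z ^ 2 ≠ 0 := fun z hz => pow_ne_zero 2 (hne z hz)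
  set e : ℝ × ℝ → ℝ := fun z => (z.1 ^ 2 + z.2 ^ 2) * (Wx z ^ 2 + Wy z ^ 2) / W z ^ 2 with he
  set A : ℝ × ℝ → ℝ := fun z => (X z * z.1 + Y z * z.2) / W z with hA
  set B : ℝ × ℝ → ℝ := fun z => (X z * -z.2 + Y z * z.1) / W z with hB
  set A' : ℝ × ℝ → ℝ := fun z =>
    (((Xx z * z.1 + Xy z * z.2) * z.1 + X z * z.1 + ((Yx z * z.1 + Yy z * z.2) * z.2 + Y z * z.2))
      * W z - (X z * z.1 + Y z * z.2) * (Wx z * z.1 + Wy z * z.2)) / W z ^ 2 with hA'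
  set B' : ℝ × ℝ → ℝ := fun z =>
    (((Xx z * -z.2 + Xy z * z.1) * -z.2 + X z * -z.1 + ((Yx z * -z.2 + Yy z * z.1) * z.1
      + Y z * -z.2)) * W z - (X z * -z.2 + Y z * z.1) * (Wx z * -z.2 + Wy z * z.1)) / W z ^ 2
    with hB'
  have ce : ContinuousOn e planeDom :=
    ContinuousOn.div (by fun_prop) (by fun_prop) hne2
  have cA : ContinuousOn A planeDom := ContinuousOn.div (by fun_prop) (by fun_prop) hne
  have cA' : ContinuousOn A' planeDom := ContinuousOn.div (by fun_prop) (by fun_prop) hne2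
  have cB' : ContinuousOn B' planeDom := ContinuousOn.div (by fun_prop) (by fun_prop) hne2
  have dxs : ∀ s θ, HasDerivAt (fun t => (polarPt t θ).1) (polarPt s θ).1 s := fun s θ =>
    (hasDerivAt_exp s).mul_const _
  have dys : ∀ s θ, HasDerivAt (fun t => (polarPt t θ).2) (polarPt s θ).2 s := fun s θ =>
    (hasDerivAt_exp s).mul_const _
  have dxt : ∀ s θ, HasDerivAt (fun t => (polarPt s t).1) (-(polarPt s θ).2) θ := fun s θ => by
    simpa [polarPt] using (hasDerivAt_cos θ).const_mul (exp s)
  have dyt : ∀ s θ, HasDerivAt (fun t => (polarPt s t).2) (polarPt s θ).1 θ := fun s θ =>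
    (hasDerivAt_sin θ).const_mul (exp s)
  have dA : ∀ s θ, 0 ≤ s → θ ∈ Icc 0 π →
      HasDerivAt (fun t => A (polarPt t θ)) (A' (polarPt s θ)) s := fun s θ hs hθ => by
    have hz := polarPt_mem hs hθ
    exact (((hasDerivAt_polarPt_left (dX _ hz)).mul (dxs s θ)).add
      ((hasDerivAt_polarPt_left (dY _ hz)).mul (dys s θ))).div
        (hasDerivAt_polarPt_left (dW _ hz)) (hne _ hz)
  have dB : ∀ s θ, 0 ≤ s → θ ∈ Icc 0 π →
      HasDerivAt (fun t => B (polarPt s t)) (B' (polarPt s θ)) θ := fun s θ hs hθ => by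
    have hz := polarPt_mem hs hθ
    exact (((hasDerivAt_polarPt_right (dX _ hz)).mul (dyt s θ).neg).add
      ((hasDerivAt_polarPt_right (dY _ hz)).mul (dxt s θ))).div
        (hasDerivAt_polarPt_right (dW _ hz)) (hne _ hz)
  have hAe : ∀ z ∈ planeDom, A z ^ 2 ≤ 36 * e z := fun z hz => by
    simp only [hA, he]
    rw [div_pow, mul_div_assoc', div_le_div_iff_of_pos_right (pow_pos (hW z hz) 2)]
    have h1 := mul_le_mul_of_nonneg_left (hgr z hz)
      (show 0 ≤ z.1 ^ 2 + z.2 ^ 2 by positivity)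
    nlinarith [sq_nonneg (X z * z.2 - Y z * z.1)]
  have hAB : ∀ z ∈ planeDom, 0 < z.2 → A' z ≤ -B' z - e z / 4 := fun z hz hz2 => by
    have h1 := mul_le_mul_of_nonneg_left (hell z hz) (show 0 ≤ z.1 ^ 2 + z.2 ^ 2 by positivity)
    have h2 : A' z + B' z = -((z.1 ^ 2 + z.2 ^ 2) * (X z * Wx z + Y z * Wy z)) / W z ^ 2 := by
      simp only [hA', hB']
      rw [← add_div]
      congr 1
      linear_combination (z.1 ^ 2 + z.2 ^ 2) * W z * hdiv z hz hz2
    have h3 : A' z + B' z ≤ -(e z / 4) := by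
      rw [h2, he, ← neg_div, neg_div, neg_div, neg_le_neg_iff, div_div, mul_comm (W z ^ 2),
        ← div_div, div_le_div_iff_of_pos_right (pow_pos (hW z hz) 2)]
      linarith
    linarith
  apply exists_le_of_dissipation (J := fun s => ∫ θ in (0 : ℝ)..π, A (polarPt s θ))
    (J' := fun s => ∫ θ in (0 : ℝ)..π, A' (polarPt s θ))
  · exact fun s hs => hasDerivAt_integral_polarPt dA cA cA' (ha.trans_lt hs.1)
  · intro s hs
    have hs0 : 0 ≤ s := ha.trans hs.1.le
    have iA' := intervalIntegrable_polarPt cA' hs0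
    have iB' := intervalIntegrable_polarPt cB' hs0
    have iB'n : IntervalIntegrable (fun θ => -B' (polarPt s θ)) volume 0 π := iB'.neg
    have ie := intervalIntegrable_polarPt ce hs0
    have hB : ∫ θ in (0 : ℝ)..π, B' (polarPt s θ) = B (polarPt s π) - B (polarPt s 0) := by
      refine intervalIntegral.integral_eq_sub_of_hasDerivAt (f := fun t => B (polarPt s t))
        (fun θ hθ => ?_) iB'
      rw [uIcc_of_le pi_pos.le] at hθ
      exact dB s θ hs0 hθ
    have hle : ∫ θ in (0 : ℝ)..π, A' (polarPt s θ) ≤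
        ∫ θ in (0 : ℝ)..π, (-B' (polarPt s θ) - e (polarPt s θ) / 4) := by
      apply intervalIntegral.integral_mono_on_of_le_Ioo pi_pos.le iA' (iB'.neg.sub (ie.div_const 4))
      intro θ hθ
      exact hAB _ (polarPt_mem hs0 (Ioo_subset_Icc_self hθ))
        (mul_pos (exp_pos s) (sin_pos_of_mem_Ioo hθ))
    rw [intervalIntegral.integral_sub iB'n (ie.div_const 4), intervalIntegral.integral_neg,
      intervalIntegral.integral_div, hB] at hle
    have m0 := polarPt_mem hs0 (left_mem_Icc.2 pi_pos.le)
    have mπ := polarPt_mem hs0 (right_mem_Icc.2 pi_pos.le)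
    have b0 : B (polarPt s 0) ≤ 0 := by
      apply div_nonpos_of_nonpos_of_nonneg _ (hW _ m0).le
      have := hbd _ m0 (by simp [polarPt])
      have h2 : 0 ≤ (polarPt s 0).1 := by simp [polarPt, (exp_pos s).le]
      have h3 : (polarPt s 0).2 = 0 := by simp [polarPt]
      rw [h3]
      nlinarith
    have bπ : 0 ≤ B (polarPt s π) := by
      apply div_nonneg _ (hW _ mπ).le
      have := hbd _ mπ (by simp [polarPt])
      have h2 : (polarPt s π).1 ≤ 0 := by simp [polarPt, (exp_pos s).le]
      have h3 : (polarPt s π).2 = 0 := by simp [polarPt]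
      rw [h3]
      nlinarith
    linarith
  · intro s hs
    have hs0 : 0 ≤ s := ha.trans hs.1.le
    have iA := intervalIntegrable_polarPt cA hs0
    have ie := intervalIntegrable_polarPt ce hs0
    have iA2 : IntervalIntegrable (fun θ => A (polarPt s θ) ^ 2) volume 0 π :=
      intervalIntegrable_polarPt (cA.pow 2) hs0
    set j : ℝ := ∫ θ in (0 : ℝ)..π, A (polarPt s θ) with hj
    have h1 : ∫ θ in (0 : ℝ)..π, A (polarPt s θ) ^ 2 ≤ ∫ θ in (0 : ℝ)..π, 36 * e (polarPt s θ) :=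
      intervalIntegral.integral_mono_on pi_pos.le iA2 (ie.const_mul 36)
        fun θ hθ => hAe _ (polarPt_mem hs0 hθ)
    rw [intervalIntegral.integral_const_mul] at h1
    have h2 : 0 ≤ ∫ θ in (0 : ℝ)..π, (A (polarPt s θ) - j / π) ^ 2 :=
      intervalIntegral.integral_nonneg pi_pos.le fun θ _ => sq_nonneg _
    have h3 : ∫ θ in (0 : ℝ)..π, (A (polarPt s θ) - j / π) ^ 2 =
        (∫ θ in (0 : ℝ)..π, A (polarPt s θ) ^ 2) - 2 * (j / π) * j + π * (j / π) ^ 2 := by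
      have : ∀ θ, (A (polarPt s θ) - j / π) ^ 2 =
          A (polarPt s θ) ^ 2 - 2 * (j / π) * A (polarPt s θ) + (j / π) ^ 2 := fun θ => by ring
      simp only [this]
      rw [intervalIntegral.integral_add (iA2.sub (iA.const_mul _)) intervalIntegrable_const,
        intervalIntegral.integral_sub iA2 (iA.const_mul _), intervalIntegral.integral_const_mul,
        intervalIntegral.integral_const, ← hj]
      simp
    have hp := pi_pos
    have h4 : 2 * (j / π) * j - π * (j / π) ^ 2 = j ^ 2 / π := by field_simp; ring
    have h5 : j ^ 2 / π ≤ 36 * ∫ θ in (0 : ℝ)..π, e (polarPt s θ) := by linarith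
    rw [div_le_iff₀ hp] at h5
    have h6 : 0 ≤ ∫ θ in (0 : ℝ)..π, e (polarPt s θ) :=
      intervalIntegral.integral_nonneg hp.le fun θ _ => by simp only [he]; positivity
    nlinarith [pi_lt_d2]

/-- Small logarithmic energy controls the oscillation on a half circle. -/
lemma le_exp_mul_of_energy {W Wx Wy : ℝ × ℝ → ℝ}
    (dW : ∀ z ∈ planeDom, HasFDerivAt W
      (Wx z • ContinuousLinearMap.fst ℝ ℝ ℝ + Wy z • ContinuousLinearMap.snd ℝ ℝ ℝ) z)
    (cWx : ContinuousOn Wx planeDom) (cWy : ContinuousOn Wy planeDom)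
    (hW : ∀ z ∈ planeDom, 0 < W z) {s K : ℝ} (hs : 0 ≤ s)
    (hK : ∫ θ in (0 : ℝ)..π, (fun z : ℝ × ℝ =>
      (z.1 ^ 2 + z.2 ^ 2) * (Wx z ^ 2 + Wy z ^ 2) / W z ^ 2) (polarPt s θ) ≤ K)
    {θ θ' : ℝ} (hθ : θ ∈ Icc 0 π) (hθ' : θ' ∈ Icc 0 π) :
    W (polarPt s θ) ≤ exp (2 + K / 2) * W (polarPt s θ') := by
  have cW : ContinuousOn W planeDom := fun z hz => (dW z hz).continuousAt.continuousWithinAt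
  have hne : ∀ z ∈ planeDom, W z ≠ 0 := fun z hz => (hW z hz).ne'
  set e : ℝ × ℝ → ℝ := fun z => (z.1 ^ 2 + z.2 ^ 2) * (Wx z ^ 2 + Wy z ^ 2) / W z ^ 2 with he
  set L : ℝ × ℝ → ℝ := fun z => (Wx z * -z.2 + Wy z * z.1) / W z with hL
  have ce : ContinuousOn e planeDom :=
    ContinuousOn.div (by fun_prop) (by fun_prop) fun z hz => pow_ne_zero 2 (hne z hz)
  have cL : ContinuousOn L planeDom := ContinuousOn.div (by fun_prop) (by fun_prop) hne
  have dL : ∀ t ∈ Icc 0 π, HasDerivAt (fun t => log (W (polarPt s t))) (L (polarPt s t)) t :=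
    fun t ht => by
      have hz := polarPt_mem hs ht
      exact (hasDerivAt_polarPt_right (dW _ hz)).log (hne _ hz)
  have hLe : ∀ z ∈ planeDom, |L z| ≤ (1 + e z) / 2 := fun z hz => by
    have h1 : L z ^ 2 ≤ e z := by
      simp only [hL, he]
      rw [div_pow, div_le_div_iff_of_pos_right (pow_pos (hW z hz) 2)]
      nlinarith [sq_nonneg (Wx z * z.1 + Wy z * z.2)]
    rw [← sq_abs] at h1
    nlinarith [sq_nonneg (|L z| - 1)]
  have ie := intervalIntegrable_polarPt ce hs
  have iL := intervalIntegrable_polarPt cL hs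
  have hsub : uIcc θ' θ ⊆ Icc 0 π := by
    rw [← uIcc_of_le pi_pos.le] at hθ hθ' ⊢
    exact uIcc_subset_uIcc hθ' hθ
  have hftc : ∫ t in θ'..θ, L (polarPt s t) = log (W (polarPt s θ)) - log (W (polarPt s θ')) := by
    apply intervalIntegral.integral_eq_sub_of_hasDerivAt fun t ht => dL t (hsub ht)
    apply iL.mono_set
    rwa [uIcc_of_le pi_pos.le]
  have hle : ∫ t in θ'..θ, L (polarPt s t) ≤ ∫ t in (0 : ℝ)..π, |L (polarPt s t)| := by
    have h0 := intervalIntegral.norm_integral_le_abs_integral_norm (μ := volume)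
      (f := fun t => L (polarPt s t)) (a := θ') (b := θ)
    simp only [norm_eq_abs] at h0
    refine (le_abs_self _).trans (h0.trans ?_)
    refine (intervalIntegral.abs_integral_mono_interval (c := 0) (d := π) ?_ ?_ iL.abs).trans ?_
    · rw [uIoc_of_le pi_pos.le]
      intro t ht
      rcases le_total θ' θ with h | h
      · rw [uIoc_of_le h] at ht
        exact ⟨hθ'.1.trans_lt ht.1, ht.2.trans hθ.2⟩
      · rw [uIoc_of_ge h] at ht
        exact ⟨hθ.1.trans_lt ht.1, ht.2.trans hθ'.2⟩
    · exact ae_of_all _ fun t => abs_nonneg _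
    · rw [abs_of_nonneg (intervalIntegral.integral_nonneg pi_pos.le fun t _ => abs_nonneg _)]
  have hle2 : ∫ t in (0 : ℝ)..π, |L (polarPt s t)| ≤
      ∫ t in (0 : ℝ)..π, (1 + e (polarPt s t)) / 2 :=
    intervalIntegral.integral_mono_on pi_pos.le iL.abs
      ((intervalIntegrable_const.add ie).div_const 2) fun t ht => hLe _ (polarPt_mem hs ht)
  rw [intervalIntegral.integral_div,
    intervalIntegral.integral_add intervalIntegrable_const ie,
    intervalIntegral.integral_const] at hle2
  simp only [sub_zero, smul_eq_mul, mul_one] at hle2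
  have h1 : log (W (polarPt s θ)) ≤ 2 + K / 2 + log (W (polarPt s θ')) := by
    linarith [pi_lt_four]
  have h2 := exp_le_exp.2 h1
  rwa [exp_add, exp_log (hW _ (polarPt_mem hs hθ)), exp_log (hW _ (polarPt_mem hs hθ'))] at h2

/-- Harnack inequality on a half circle for hodograph solutions. -/
lemma PlaneSol.harnack {V P Q R S T F₁ F₂ F₁p F₁q F₂p F₂q : ℝ × ℝ → ℝ} {σ δ m : ℝ}
    (hs : PlaneSol V P Q R S T) (hσ : σ = 1 ∨ σ = -1)
    (hF : IsFlux σ δ F₁ F₂ F₁p F₁q F₂p F₂q)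
    (hP : ∀ z ∈ planeDom, |P z| ≤ δ) (hQ : ∀ z ∈ planeDom, |Q z| ≤ δ)
    (hm : ∀ z ∈ planeDom, m < σ * V z) {a : ℝ} (ha : 0 ≤ a) :
    ∃ s ∈ Ioo a (a + 1 / 2), ∀ θ ∈ Icc 0 π, ∀ θ' ∈ Icc 0 π,
      σ * V (polarPt s θ) - m ≤ exp 2000002 * (σ * V (polarPt s θ') - m) := by
  have hσ2 : σ * σ = 1 := by rcases hσ with rfl | rfl <;> norm_num
  have cP : ContinuousOn P planeDom := fun z hz => (hs.dP z hz).continuousAt.continuousWithinAt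
  have cQ : ContinuousOn Q planeDom := fun z hz => (hs.dQ z hz).continuousAt.continuousWithinAt
  have comp : ∀ {F Fp Fq : ℝ × ℝ → ℝ}, (∀ z : ℝ × ℝ, |z.1| ≤ δ → |z.2| ≤ δ → HasFDerivAt F
      (Fp z • ContinuousLinearMap.fst ℝ ℝ ℝ + Fq z • ContinuousLinearMap.snd ℝ ℝ ℝ) z) →
      ∀ z ∈ planeDom, HasFDerivAt (fun z => σ * F (P z, Q z))
        ((σ * (Fp (P z, Q z) * R z + Fq (P z, Q z) * S z)) • ContinuousLinearMap.fst ℝ ℝ ℝ +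
        (σ * (Fp (P z, Q z) * S z + Fq (P z, Q z) * T z)) • ContinuousLinearMap.snd ℝ ℝ ℝ) z := by
    intro F Fp Fq h z hz
    have h1 := ((h (P z, Q z) (hP z hz) (hQ z hz)).comp z
      ((hs.dP z hz).prodMk (hs.dQ z hz))).const_mul σ
    refine h1.congr_fderiv ?_
    ext <;> simp [mul_add]
  have compc : ∀ {F : ℝ × ℝ → ℝ}, (∀ z : ℝ × ℝ, |z.1| ≤ δ → |z.2| ≤ δ → ContinuousAt F z) →
      ContinuousOn (fun z => F (P z, Q z)) planeDom := fun h z hz =>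
    ContinuousAt.comp_continuousWithinAt (f := fun z => (P z, Q z))
      (h (P z, Q z) (hP z hz) (hQ z hz)) ((cP z hz).prodMk (cQ z hz))
  have cR := hs.cR
  have cS := hs.cS
  have cT := hs.cT
  have c1 := compc hF.c₁p
  have c2 := compc hF.c₁q
  have c3 := compc hF.c₂p
  have c4 := compc hF.c₂q
  have dW : ∀ z ∈ planeDom, HasFDerivAt (fun z => σ * V z - m)
      ((σ * P z) • ContinuousLinearMap.fst ℝ ℝ ℝ + (σ * Q z) • ContinuousLinearMap.snd ℝ ℝ ℝ) z :=
    fun z hz => by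
      refine (((hs.dV z hz).const_mul σ).sub_const m).congr_fderiv ?_
      ext <;> simp
  have hW : ∀ z ∈ planeDom, 0 < σ * V z - m := fun z hz => sub_pos.2 (hm z hz)
  obtain ⟨s, hsa, hE⟩ := exists_small_energy dW (comp hF.d₁) (comp hF.d₂)
    (cP.const_mul σ) (cQ.const_mul σ) (((c1.mul cR).add (c2.mul cS)).const_mul σ)
    (((c1.mul cS).add (c2.mul cT)).const_mul σ) (((c3.mul cR).add (c4.mul cS)).const_mul σ)
    (((c3.mul cS).add (c4.mul cT)).const_mul σ) hW
    (fun z hz hz2 => by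
      rw [← mul_add, hF.conservation (P z, Q z) (hP z hz) (hQ z hz) _ _ _ (hs.pde z hz hz2),
        mul_zero])
    (fun z hz => by
      have := hF.elliptic (P z, Q z) (hP z hz) (hQ z hz)
      simp only at this
      linear_combination this + (P z ^ 2 / 4 + Q z ^ 2 / 4 - F₁ (P z, Q z) * P z -
        F₂ (P z, Q z) * Q z) * hσ2)
    (fun z hz => by
      have := hF.growth (P z, Q z) (hP z hz) (hQ z hz)
      simp only at this
      linear_combination this + (F₁ (P z, Q z) ^ 2 + F₂ (P z, Q z) ^ 2 -
        36 * (P z ^ 2 + Q z ^ 2)) * hσ2)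
    (fun z hz hz2 => hF.boundary (P z, Q z) (hP z hz) (hQ z hz) (hs.bc z hz hz2)) ha
  refine ⟨s, hsa, fun θ hθ θ' hθ' => ?_⟩
  have := le_exp_mul_of_energy dW (cP.const_mul σ) (cQ.const_mul σ) hW (ha.trans hsa.1.le) hE
    hθ hθ'
  norm_num at this ⊢
  exact this

lemma exists_polarPt_eq {z : ℝ × ℝ} {s : ℝ} (h2 : 0 ≤ z.2)
    (hz : z.1 ^ 2 + z.2 ^ 2 = exp s ^ 2) : ∃ θ ∈ Icc 0 π, polarPt s θ = z := by
  have he := exp_pos s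
  have habs : |z.1| ≤ exp s := abs_le_of_sq_le_sq (by nlinarith [sq_nonneg z.2]) he.le
  have h1 : -1 ≤ z.1 / exp s := by rw [le_div_iff₀ he]; linarith [(abs_le.1 habs).1]
  have h1' : z.1 / exp s ≤ 1 := by rw [div_le_one he]; exact (abs_le.1 habs).2
  refine ⟨arccos (z.1 / exp s), ⟨arccos_nonneg _, arccos_le_pi _⟩, Prod.ext ?_ ?_⟩
  · simp only [polarPt]
    rw [cos_arccos h1 h1']
    field_simp
  · simp only [polarPt]
    rw [sin_arccos]
    have : 1 - (z.1 / exp s) ^ 2 = (z.2 / exp s) ^ 2 := by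
      field_simp
      linarith
    rw [this, sqrt_sq (div_nonneg h2 he.le)]
    field_simp

lemma barrier_polarPt (τ s θ : ℝ) :
    barrier τ (polarPt s θ) = τ * s + exp (-s) - 1 + (sin θ * exp (-s) - 1) / 10 := by
  have he := exp_pos s
  rw [barrier, polarPt_sq, sqrt_sq he.le, log_pow, log_exp, exp_neg]
  simp only [polarPt]
  field_simp
  push_cast
  ring

lemma barrier_polarPt_le {τ s θ : ℝ} (hs : 0 ≤ s) (hθ : θ ∈ Icc 0 π) :
    barrier τ (polarPt s θ) ≤ τ * s := by
  rw [barrier_polarPt]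
  have h1 : exp (-s) ≤ 1 := exp_le_one_iff.2 (by linarith)
  have h2 := sin_nonneg_of_mem_Icc hθ
  nlinarith [sin_le_one θ, exp_pos (-s)]

lemma le_barrier_polarPt_log_two {θ : ℝ} (hθ : θ ∈ Icc 0 π) :
    9 / 100 ≤ barrier 1 (polarPt (log 2) θ) := by
  rw [barrier_polarPt, exp_neg, exp_log two_pos]
  linarith [sin_nonneg_of_mem_Icc hθ, log_two_gt_d9]

lemma le_of_forall_small_mul {k b x : ℝ} (h : ∀ a, 0 < a → a ≤ 1 / 1000 → k + a * b ≤ x) :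
    k ≤ x := by
  have h1 : Filter.Tendsto (fun a : ℝ => k + a * b) (nhdsWithin 0 (Ioi 0)) (nhds k) := by
    have : ContinuousWithinAt (fun a : ℝ => k + a * b) (Ioi 0) 0 := by fun_prop
    simpa [ContinuousWithinAt] using this
  refine le_of_tendsto h1 ?_
  filter_upwards [Ioc_mem_nhdsGT (show (0 : ℝ) < 1 / 1000 by norm_num)] with a ha
  exact h a ha.1 ha.2

/-- The comparison principle in logarithmic polar coordinates. -/
lemma PlaneSol.comparison_polar {V P Q R S T : ℝ × ℝ → ℝ} (hs : PlaneSol V P Q R S T)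
    {σ τ a k s₁ s₂ : ℝ} (hσ : σ = 1 ∨ σ = -1) (hτ : |τ| ≤ 1) (ha : 0 < a) (ha1 : a ≤ 1 / 1000)
    (hs₁ : 0 ≤ s₁)
    (h1 : ∀ θ ∈ Icc 0 π, k + a * barrier τ (polarPt s₁ θ) ≤ σ * V (polarPt s₁ θ))
    (h2 : ∀ θ ∈ Icc 0 π, k + a * barrier τ (polarPt s₂ θ) ≤ σ * V (polarPt s₂ θ))
    {s θ : ℝ} (hs1 : s₁ ≤ s) (hs2 : s ≤ s₂) (hθ : θ ∈ Icc 0 π) :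
    k + a * barrier τ (polarPt s θ) ≤ σ * V (polarPt s θ) := by
  have hmono : ∀ {x y : ℝ}, x ≤ y → exp x ^ 2 ≤ exp y ^ 2 := fun h =>
    pow_le_pow_left₀ (exp_pos _).le (exp_le_exp.2 h) 2
  refine hs.comparison hσ hτ ha ha1 (ρ₁ := exp s₁ ^ 2) (ρ₂ := exp s₂ ^ 2)
    (one_le_pow₀ (one_le_exp hs₁)) ?_ ?_ (polarPt_mem (hs₁.trans hs1) hθ).1 ?_ ?_
  · intro z hz hz2
    obtain ⟨t, ht, rfl⟩ := exists_polarPt_eq hz hz2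
    exact h1 t ht
  · intro z hz hz2
    obtain ⟨t, ht, rfl⟩ := exists_polarPt_eq hz hz2
    exact h2 t ht
  · rw [polarPt_sq]; exact hmono hs1
  · rw [polarPt_sq]; exact hmono hs2

/-- Solutions bounded from below are bounded by their minimum on any inner half circle. -/
lemma PlaneSol.ge_of_bddBelow {V P Q R S T : ℝ × ℝ → ℝ} (hs : PlaneSol V P Q R S T)
    {σ B m s₀ : ℝ} (hσ : σ = 1 ∨ σ = -1) (hB : ∀ z ∈ planeDom, B ≤ σ * V z) (hs₀ : 0 ≤ s₀)
    (hm : ∀ θ ∈ Icc 0 π, m ≤ σ * V (polarPt s₀ θ)) {s θ : ℝ} (h : s₀ ≤ s) (hθ : θ ∈ Icc 0 π) :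
    m ≤ σ * V (polarPt s θ) := by
  refine le_of_forall_small_mul (b := barrier (-1) (polarPt s θ)) fun a ha ha1 => ?_
  have hs' : s₀ ≤ max s ((m - B) / a) := h.trans (le_max_left _ _)
  refine hs.comparison_polar (s₂ := max s ((m - B) / a)) hσ (by norm_num) ha ha1 hs₀
    (fun t ht => ?_) (fun t ht => ?_) h (le_max_left _ _) hθ
  · have := barrier_polarPt_le (τ := -1) hs₀ ht
    nlinarith [hm t ht]
  · have h1 := barrier_polarPt_le (τ := -1) (hs₀.trans hs') ht
    have h2 := hB _ (polarPt_mem (hs₀.trans hs') ht)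
    have h3 := (div_le_iff₀ ha).1 (le_max_right s ((m - B) / a))
    nlinarith

/-- The maximum principle on a half annulus. -/
lemma PlaneSol.le_of_circles {V P Q R S T : ℝ × ℝ → ℝ} (hs : PlaneSol V P Q R S T)
    {σ M s₁ s₂ : ℝ} (hσ : σ = 1 ∨ σ = -1) (hs₁ : 0 ≤ s₁)
    (h1 : ∀ θ ∈ Icc 0 π, σ * V (polarPt s₁ θ) ≤ M)
    (h2 : ∀ θ ∈ Icc 0 π, σ * V (polarPt s₂ θ) ≤ M)
    {s θ : ℝ} (hs1 : s₁ ≤ s) (hs2 : s ≤ s₂) (hθ : θ ∈ Icc 0 π) :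
    σ * V (polarPt s θ) ≤ M := by
  have key : -M ≤ -σ * V (polarPt s θ) := by
    refine le_of_forall_small_mul (b := barrier 0 (polarPt s θ)) fun a ha ha1 => ?_
    refine hs.comparison_polar (s₂ := s₂) (by rcases hσ with rfl | rfl <;> simp) (by norm_num)
      ha ha1 hs₁ (fun t ht => ?_) (fun t ht => ?_) hs1 hs2 hθ
    · have := barrier_polarPt_le (τ := 0) hs₁ ht
      nlinarith [h1 t ht]
    · have := barrier_polarPt_le (τ := 0) ((hs₁.trans hs1).trans hs2) ht
      nlinarith [h2 t ht]
  linarith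

/-- Logarithmic growth of the minimum over half circles. -/
lemma PlaneSol.min_growth {V P Q R S T : ℝ × ℝ → ℝ} (hs : PlaneSol V P Q R S T)
    {σ m₁ m₂ μ s θ₂ : ℝ} (hσ : σ = 1 ∨ σ = -1)
    (h1 : ∀ θ ∈ Icc 0 π, m₁ ≤ σ * V (polarPt 0 θ)) (hθ₂ : θ₂ ∈ Icc 0 π)
    (h2 : σ * V (polarPt (log 2) θ₂) ≤ m₂) (hlt : m₂ - m₁ < 9 / 100000) (h12 : m₁ ≤ m₂)
    (hsl : log 2 ≤ s) (hμ : ∀ θ ∈ Icc 0 π, μ ≤ σ * V (polarPt s θ)) :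
    μ - m₁ ≤ 12 * s * (m₂ - m₁) := by
  have hl := log_two_gt_d9
  have hs0 : 0 < s := by linarith
  rcases le_or_gt μ m₁ with hle | hgt
  · have : 0 ≤ 12 * s * (m₂ - m₁) := mul_nonneg (by linarith) (by linarith)
    linarith
  have ha : 0 < min (1 / 1000) ((μ - m₁) / s) :=
    lt_min (by norm_num) (div_pos (by linarith) hs0)
  set a := min (1 / 1000) ((μ - m₁) / s) with ha_def
  have hc := hs.comparison_polar (τ := 1) (k := m₁) hσ (by norm_num) ha (min_le_left _ _) le_rfl
    (s₂ := s) (fun t ht => ?_) (fun t ht => ?_) (by linarith : 0 ≤ log 2) hsl hθ₂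
  · have h3 := le_barrier_polarPt_log_two hθ₂
    have h4 : a * (9 / 100) ≤ m₂ - m₁ := by nlinarith
    have h5 : a < 1 / 1000 := by linarith
    have h6 : a = (μ - m₁) / s := by
      rcases min_choice (1 / 1000) ((μ - m₁) / s) with h | h
      · rw [ha_def, h] at h5; exact absurd h5 (lt_irrefl _)
      · exact h
    have h7 : μ - m₁ = a * s := by rw [h6]; field_simp
    nlinarith
  · have := barrier_polarPt_le (τ := 1) le_rfl ht
    nlinarith [h1 t ht]
  · have h3 := barrier_polarPt_le (τ := 1) hs0.le ht
    have h4 := (le_div_iff₀ hs0).1 (min_le_right (1 / 1000) ((μ - m₁) / s))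
    nlinarith [hμ t ht]

/-- Growth estimate for one-sided bounded planar hodograph solutions. -/
lemma PlaneSol.growth {V P Q R S T F₁ F₂ F₁p F₁q F₂p F₂q : ℝ × ℝ → ℝ} {σ δ η B m₁ m₂ θ₁ θ₂ : ℝ}
    (hs : PlaneSol V P Q R S T) (hσ : σ = 1 ∨ σ = -1)
    (hF : IsFlux σ δ F₁ F₂ F₁p F₁q F₂p F₂q) (hηδ : η ≤ δ) (hη : η ≤ 1 / 100000)
    (hP : ∀ z ∈ planeDom, |P z| ≤ η) (hQ : ∀ z ∈ planeDom, |Q z| ≤ η)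
    (hB : ∀ z ∈ planeDom, B ≤ σ * V z)
    (h1 : ∀ θ ∈ Icc 0 π, m₁ ≤ σ * V (polarPt 0 θ)) (hθ₁ : θ₁ ∈ Icc 0 π)
    (e1 : σ * V (polarPt 0 θ₁) = m₁)
    (h2 : ∀ θ ∈ Icc 0 π, m₂ ≤ σ * V (polarPt (log 2) θ)) (hθ₂ : θ₂ ∈ Icc 0 π)
    (e2 : σ * V (polarPt (log 2) θ₂) = m₂) {s θ : ℝ} (hsl : log 2 ≤ s) (hθ : θ ∈ Icc 0 π) :
    0 ≤ σ * V (polarPt s θ) - m₁ ∧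
      σ * V (polarPt s θ) - m₁ ≤ 12 * exp 2000002 * (1 + s) * (m₂ - m₁) := by
  have hl := log_two_gt_d9
  have hl' := log_two_lt_d9
  have hge : ∀ {s θ : ℝ}, 0 ≤ s → θ ∈ Icc 0 π → m₁ ≤ σ * V (polarPt s θ) := fun h hθ =>
    hs.ge_of_bddBelow hσ hB le_rfl h1 h hθ
  have h12 : m₁ ≤ m₂ := e2 ▸ hge (by linarith) hθ₂
  have hs0 : 0 < s := by linarith
  refine ⟨by linarith [hge hs0.le hθ], ?_⟩
  have hlt : m₂ - m₁ < 9 / 100000 := by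
    have hd : ∀ t ∈ Icc 0 (log 2), HasDerivAt (fun t => σ * V (polarPt t θ₁))
        (σ * (P (polarPt t θ₁) * (polarPt t θ₁).1 + Q (polarPt t θ₁) * (polarPt t θ₁).2)) t :=
      fun t ht => (hasDerivAt_polarPt_left (hs.dV _ (polarPt_mem ht.1 hθ₁))).const_mul σ
    obtain ⟨t, ht, he⟩ := exists_hasDerivAt_eq_slope _ _ (show 0 < log 2 by linarith)
      (fun t ht => (hd t ht).continuousAt.continuousWithinAt)
      (fun t ht => hd t (Ioo_subset_Icc_self ht))
    have hz := polarPt_mem ht.1.le hθ₁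
    have hexp : exp t ≤ 2 := by
      rw [← exp_log (show (0 : ℝ) < 2 by norm_num)]; exact exp_le_exp.2 ht.2.le
    have hx : |(polarPt t θ₁).1| ≤ 2 := by
      simp only [polarPt]
      rw [abs_mul, abs_of_pos (exp_pos t)]
      nlinarith [abs_cos_le_one θ₁, exp_pos t]
    have hy : |(polarPt t θ₁).2| ≤ 2 := by
      simp only [polarPt]
      rw [abs_mul, abs_of_pos (exp_pos t)]
      nlinarith [abs_sin_le_one θ₁, exp_pos t]
    have h3 : |P (polarPt t θ₁) * (polarPt t θ₁).1 + Q (polarPt t θ₁) * (polarPt t θ₁).2| ≤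
        1 / 100000 * 2 + 1 / 100000 * 2 := by
      refine (abs_add_le _ _).trans (add_le_add ?_ ?_)
      · rw [abs_mul]
        exact mul_le_mul ((hP _ hz).trans hη) hx (abs_nonneg _) (by norm_num)
      · rw [abs_mul]
        exact mul_le_mul ((hQ _ hz).trans hη) hy (abs_nonneg _) (by norm_num)
    have h4 : |σ| = 1 := by rcases hσ with rfl | rfl <;> simp
    have h5 := le_abs_self (σ * (P (polarPt t θ₁) * (polarPt t θ₁).1 +
      Q (polarPt t θ₁) * (polarPt t θ₁).2))
    rw [abs_mul, h4, one_mul] at h5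
    have h6 : σ * V (polarPt (log 2) θ₁) - σ * V (polarPt 0 θ₁) ≤
        (1 / 100000 * 2 + 1 / 100000 * 2) * (log 2 - 0) := by
      rw [← div_le_iff₀ (by linarith), ← he]
      exact h5.trans h3
    have := h2 θ₁ hθ₁
    linarith
  have hmin : ∀ t, 0 ≤ t → ∃ φ ∈ Icc 0 π, ∀ θ ∈ Icc 0 π,
      σ * V (polarPt t φ) ≤ σ * V (polarPt t θ) := fun t ht =>
    isCompact_Icc.exists_isMinOn (nonempty_Icc.2 pi_pos.le)
      (continuousOn_polarPt_right (f := fun z => σ * V z)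
        (fun z hz => ((hs.dV z hz).continuousAt.continuousWithinAt).const_mul σ) ht)
  have key : ∀ ε : ℝ, 0 < ε → σ * V (polarPt s θ) - m₁ ≤
      12 * exp 2000002 * (1 + s) * (m₂ - m₁) + ε * exp 2000002 := by
    intro ε hε
    have hm : ∀ z ∈ planeDom, m₁ - ε < σ * V z := fun z hz => by
      have hpos : 0 < z.1 ^ 2 + z.2 ^ 2 := by linarith [hz.2]
      have hρ : z.1 ^ 2 + z.2 ^ 2 = exp (log (z.1 ^ 2 + z.2 ^ 2) / 2) ^ 2 := by
        rw [← exp_nat_mul]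
        push_cast
        rw [mul_div_cancel₀ _ two_ne_zero, exp_log hpos]
      obtain ⟨t, ht, hzt⟩ := exists_polarPt_eq hz.1 hρ
      have := hge (div_nonneg (log_nonneg hz.2) zero_le_two) ht
      rw [hzt] at this
      linarith
    have hP' := fun z hz => (hP z hz).trans hηδ
    have hQ' := fun z hz => (hQ z hz).trans hηδ
    obtain ⟨s₁, hs₁, H1⟩ := hs.harnack hσ hF hP' hQ' hm (a := s - 1 / 2) (by linarith)
    obtain ⟨s₂, hs₂, H2⟩ := hs.harnack hσ hF hP' hQ' hm (a := s) hs0.le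
    have hs₁0 : 0 ≤ s₁ := by linarith [hs₁.1]
    have hs₁s : s₁ ≤ s := by linarith [hs₁.2]
    obtain ⟨φ₁, hφ₁, M1⟩ := hmin s₁ hs₁0
    obtain ⟨φ₂, hφ₂, M2⟩ := hmin s₂ (hs0.le.trans hs₂.1.le)
    have hg := hs.min_growth hσ h1 hθ₂ e2.le hlt h12 (hsl.trans hs₂.1.le) M2
    have hmm : σ * V (polarPt s₁ φ₁) ≤ σ * V (polarPt s₂ φ₂) :=
      hs.ge_of_bddBelow hσ hB hs₁0 M1 (hs₁s.trans hs₂.1.le) hφ₂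
    have hg2 : 12 * s₂ * (m₂ - m₁) ≤ 12 * (1 + s) * (m₂ - m₁) :=
      mul_le_mul_of_nonneg_right (by linarith [hs₂.2]) (by linarith)
    have hK := (exp_pos 2000002).le
    generalize exp 2000002 = K at hK H1 H2 ⊢
    have hfin := hs.le_of_circles (M := m₁ - ε + K * (12 * (1 + s) * (m₂ - m₁) + ε)) hσ hs₁0
      (fun t ht => ?_) (fun t ht => ?_) hs₁s hs₂.1.le hθ
    · linarith
    · have h3 := H1 t ht φ₁ hφ₁
      have h4 : K * (σ * V (polarPt s₁ φ₁) - (m₁ - ε)) ≤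
          K * (12 * (1 + s) * (m₂ - m₁) + ε) := mul_le_mul_of_nonneg_left (by linarith) hK
      linarith
    · have h3 := H2 t ht φ₂ hφ₂
      have h4 : K * (σ * V (polarPt s₂ φ₂) - (m₁ - ε)) ≤
          K * (12 * (1 + s) * (m₂ - m₁) + ε) := mul_le_mul_of_nonneg_left (by linarith) hK
      linarith
  refine le_of_forall_pos_le_add fun ε hε => ?_
  have h3 := key (ε / exp 2000002) (div_pos hε (exp_pos _))
  rwa [div_mul_cancel₀ _ (exp_pos _).ne'] at h3

/-- The identification of `ℝ × ℝ` with the euclidean plane. -/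
def planePt : ℝ × ℝ →L[ℝ] EuclideanSpace ℝ (Fin 2) :=
  (ContinuousLinearMap.fst ℝ ℝ ℝ).smulRight (EuclideanSpace.single 0 1) +
    (ContinuousLinearMap.snd ℝ ℝ ℝ).smulRight (EuclideanSpace.single 1 1)

lemma planePt_apply_zero (z : ℝ × ℝ) : planePt z 0 = z.1 := by simp [planePt]

lemma planePt_apply_one (z : ℝ × ℝ) : planePt z 1 = z.2 := by simp [planePt]

lemma lastIdx_two (h : 0 < 2) : lastIdx 2 h = 1 := rfl

lemma planePt_coords (y : EuclideanSpace ℝ (Fin 2)) : planePt (y 0, y 1) = y := by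
  ext i
  fin_cases i
  · exact planePt_apply_zero _
  · exact planePt_apply_one _

lemma norm_planePt_sq (z : ℝ × ℝ) : ‖planePt z‖ ^ 2 = z.1 ^ 2 + z.2 ^ 2 := by
  rw [EuclideanSpace.real_norm_sq_eq, Fin.sum_univ_two, planePt_apply_zero, planePt_apply_one]

lemma norm_planePt_polarPt (s θ : ℝ) : ‖planePt (polarPt s θ)‖ = exp s := by
  rw [← sq_eq_sq₀ (norm_nonneg _) (exp_pos s).le, norm_planePt_sq, polarPt_sq]

lemma planePt_mem_extDom {z : ℝ × ℝ} (h : 0 < 2) : planePt z ∈ extDom 2 h ↔ z ∈ planeDom := by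
  change 0 ≤ planePt z 1 ∧ 1 ≤ ‖planePt z‖ ↔ 0 ≤ z.2 ∧ 1 ≤ z.1 ^ 2 + z.2 ^ 2
  rw [planePt_apply_one, ← norm_planePt_sq, one_le_sq_iff₀ (norm_nonneg _)]

lemma exists_polar_of_nonneg {y : EuclideanSpace ℝ (Fin 2)} {s : ℝ} (hy : 0 ≤ y 1)
    (hn : ‖y‖ = exp s) : ∃ θ ∈ Icc 0 π, planePt (polarPt s θ) = y := by
  obtain ⟨θ, hθ, h⟩ := exists_polarPt_eq (z := (y 0, y 1)) (s := s) hy (by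
    rw [← norm_planePt_sq, planePt_coords, hn])
  exact ⟨θ, hθ, by rw [h, planePt_coords]⟩

lemma upSphere_exp (h : 0 < 2) (s : ℝ) :
    upSphere 2 h (exp s) = (fun θ => planePt (polarPt s θ)) '' Icc 0 π := by
  ext y
  constructor
  · rintro ⟨h1, h2⟩
    exact exists_polar_of_nonneg h1 h2
  · rintro ⟨θ, hθ, rfl⟩
    refine ⟨?_, norm_planePt_polarPt s θ⟩
    rw [lastIdx_two, planePt_apply_one]
    exact mul_nonneg (exp_pos s).le (sin_nonneg_of_mem_Icc hθ)

lemma hodOp_two (h : 0 < 2) (v : EuclideanSpace ℝ (Fin 2) → ℝ) (y : EuclideanSpace ℝ (Fin 2)) :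
    hodOp 2 h v y = hessC 2 v y 0 0 + gradC 2 v y 0 / (1 + gradC 2 v y 1) * hessC 2 v y 0 1 +
      gradC 2 v y 0 / (1 + gradC 2 v y 1) * hessC 2 v y 1 0 +
      (1 + gradC 2 v y 0 ^ 2) / (1 + gradC 2 v y 1) ^ 2 * hessC 2 v y 1 1 := by
  simp [hodOp, hodA, tangSq, lastIdx_two, Fin.sum_univ_two]
  ring

lemma hodN_two (h : 0 < 2) (p : Fin 2 → ℝ) : hodN 2 h p = √(1 + p 0 ^ 2) - 1 := by
  simp [hodN, tangSq, lastIdx_two, Fin.sum_univ_two]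

lemma comp_planePt (L : EuclideanSpace ℝ (Fin 2) →L[ℝ] ℝ) :
    L ∘L planePt = L (EuclideanSpace.single 0 1) • ContinuousLinearMap.fst ℝ ℝ ℝ +
      L (EuclideanSpace.single 1 1) • ContinuousLinearMap.snd ℝ ℝ ℝ := by
  ext <;> simp [planePt]

lemma hessC_comm {v : EuclideanSpace ℝ (Fin 2) → ℝ} {y : EuclideanSpace ℝ (Fin 2)}
    (h : ContDiffAt ℝ (⊤ : ℕ∞) v y) (i j : Fin 2) : hessC 2 v y i j = hessC 2 v y j i := by
  have h2 : IsSymmSndFDerivAt ℝ v y := h.isSymmSndFDerivAt (by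
    rw [minSmoothness_of_isRCLikeNormedField]; norm_cast)
  have hd : DifferentiableAt ℝ (fderiv ℝ v) y :=
    (h.fderiv_right (m := 1) (by norm_cast)).differentiableAt (by norm_num)
  have he : ∀ i j, hessC 2 v y i j =
      fderiv ℝ (fderiv ℝ v) y (EuclideanSpace.single j 1) (EuclideanSpace.single i 1) := by
    intro i j
    rw [hessC, fderiv_clm_apply hd (differentiableAt_const _)]
    simp
  rw [he, he, h2.eq]

/-- A solution in the euclidean plane, read in coordinates. -/
lemma IsHodSol.planeSol {h : 0 < 2} {v : EuclideanSpace ℝ (Fin 2) → ℝ}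
    (hv : IsHodSol 2 h v (extDom 2 h)) :
    PlaneSol (fun z => v (planePt z)) (fun z => gradC 2 v (planePt z) 0)
      (fun z => gradC 2 v (planePt z) 1) (fun z => hessC 2 v (planePt z) 0 0)
      (fun z => hessC 2 v (planePt z) 0 1) (fun z => hessC 2 v (planePt z) 1 1) := by
  obtain ⟨⟨W, hWo, hWs, hWc⟩, hpde, hbc⟩ := hv
  have hsm : ∀ z ∈ planeDom, ContDiffAt ℝ (⊤ : ℕ∞) v (planePt z) := fun z hz =>
    hWc.contDiffAt (hWo.mem_nhds (hWs ((planePt_mem_extDom h).2 hz)))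
  have hgrad : ∀ z ∈ planeDom, ∀ i,
      ContDiffAt ℝ (⊤ : ℕ∞) (fun y => gradC 2 v y i) (planePt z) := fun z hz i =>
    ((hsm z hz).fderiv_right (m := (⊤ : ℕ∞)) (by norm_cast)).clm_apply contDiffAt_const
  have hhess : ∀ z ∈ planeDom, ∀ i j,
      ContinuousAt (fun z => hessC 2 v (planePt z) i j) z := fun z hz i j => by
    have : ContinuousAt (fun y => hessC 2 v y i j) (planePt z) :=
      (((hgrad z hz i).fderiv_right (m := 0) (by norm_cast)).clm_apply
        contDiffAt_const).continuousAt
    exact ContinuousAt.comp (g := fun y => hessC 2 v y i j) this planePt.continuous.continuousAt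
  have hdg : ∀ z ∈ planeDom, ∀ i, HasFDerivAt (fun z => gradC 2 v (planePt z) i)
      (hessC 2 v (planePt z) i 0 • ContinuousLinearMap.fst ℝ ℝ ℝ +
        hessC 2 v (planePt z) i 1 • ContinuousLinearMap.snd ℝ ℝ ℝ) z := fun z hz i => by
    have := ((hgrad z hz i).differentiableAt (by norm_num)).hasFDerivAt.comp z planePt.hasFDerivAt
    rwa [comp_planePt] at this
  refine ⟨fun z hz => ?_, fun z hz => hdg z hz 0, fun z hz => ?_,
    fun z hz => (hhess z hz 0 0).continuousWithinAt,
    fun z hz => (hhess z hz 0 1).continuousWithinAt,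
    fun z hz => (hhess z hz 1 1).continuousWithinAt, fun z hz hz2 => ?_, fun z hz hz2 => ?_⟩
  · have := ((hsm z hz).differentiableAt (by norm_num)).hasFDerivAt.comp z planePt.hasFDerivAt
    rwa [comp_planePt] at this
  · rw [hessC_comm (hsm z hz) 0 1]
    exact hdg z hz 1
  · have := hpde _ ((planePt_mem_extDom h).2 hz) (by
      rw [lastIdx_two, planePt_apply_one]; exact hz2)
    rw [hodOp_two, hessC_comm (hsm z hz) 1 0] at this
    linarith
  · have := hbc _ ((planePt_mem_extDom h).2 hz) (by
      rw [lastIdx_two, planePt_apply_one]; exact hz2)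
    rw [hodN_two, lastIdx_two] at this
    exact this

lemma abs_gradC_le (v : EuclideanSpace ℝ (Fin 2) → ℝ) (y : EuclideanSpace ℝ (Fin 2)) (i : Fin 2) :
    |gradC 2 v y i| ≤ ‖fderiv ℝ v y‖ := by
  have := (fderiv ℝ v y).le_opNorm (EuclideanSpace.single i 1)
  simpa [gradC] using this

/-- The growth estimate for `σ v`, with explicit minimizers on the half circles. -/
lemma IsHodSol.growth {h : 0 < 2} {v : EuclideanSpace ℝ (Fin 2) → ℝ} {σ δ η B : ℝ}
    {F₁ F₂ F₁p F₁q F₂p F₂q : ℝ × ℝ → ℝ}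
    (hv : IsHodSol 2 h v (extDom 2 h)) (hσ : σ = 1 ∨ σ = -1)
    (hF : IsFlux σ δ F₁ F₂ F₁p F₁q F₂p F₂q) (hηδ : η ≤ δ) (hη : η ≤ 1 / 100000)
    (hgrad : ∀ y ∈ extDom 2 h, ‖fderiv ℝ v y‖ ≤ η)
    (hB : ∀ y ∈ extDom 2 h, B ≤ σ * v y) :
    ∃ m₁ m₂ : ℝ, IsLeast ((fun y => σ * v y) '' upSphere 2 h 1) m₁ ∧
      IsLeast ((fun y => σ * v y) '' upSphere 2 h 2) m₂ ∧
      ∀ y ∈ extDom 2 h, 2 ≤ ‖y‖ → 0 ≤ σ * v y - m₁ ∧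
        σ * v y - m₁ ≤ 12 * exp 2000002 * (1 + log ‖y‖) * (m₂ - m₁) := by
  have hs := hv.planeSol
  have hmem : ∀ {z}, z ∈ planeDom → planePt z ∈ extDom 2 h := (planePt_mem_extDom h).2
  have hleast : ∀ s : ℝ, 0 ≤ s → ∃ θ ∈ Icc 0 π,
      (∀ t ∈ Icc 0 π, σ * v (planePt (polarPt s θ)) ≤ σ * v (planePt (polarPt s t))) ∧
      IsLeast ((fun y => σ * v y) '' upSphere 2 h (exp s)) (σ * v (planePt (polarPt s θ))) := by
    intro s hs0
    obtain ⟨θ, hθ, hmin⟩ := isCompact_Icc.exists_isMinOn (nonempty_Icc.2 pi_pos.le)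
      (continuousOn_polarPt_right (f := fun z => σ * v (planePt z))
        (fun z hz => ((hs.dV z hz).continuousAt.continuousWithinAt).const_mul σ) hs0)
    refine ⟨θ, hθ, hmin, ?_, ?_⟩
    · rw [upSphere_exp, image_image]
      exact ⟨θ, hθ, rfl⟩
    · rw [upSphere_exp, image_image]
      rintro _ ⟨t, ht, rfl⟩
      exact hmin ht
  obtain ⟨θ₁, hθ₁, h1, l1⟩ := hleast 0 le_rfl
  obtain ⟨θ₂, hθ₂, h2, l2⟩ := hleast (log 2) (log_nonneg one_le_two)
  rw [exp_zero] at l1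
  rw [exp_log two_pos] at l2
  refine ⟨_, _, l1, l2, fun y hy hy2 => ?_⟩
  have hpos : 0 < ‖y‖ := by linarith
  obtain ⟨θ, hθ, hyθ⟩ := exists_polar_of_nonneg (s := log ‖y‖) hy.1 (exp_log hpos).symm
  have hgr := hs.growth hσ hF hηδ hη
    (fun z hz => (abs_gradC_le v _ 0).trans (hgrad _ (hmem hz)))
    (fun z hz => (abs_gradC_le v _ 1).trans (hgrad _ (hmem hz)))
    (fun z hz => hB _ (hmem hz)) h1 hθ₁ rfl h2 hθ₂ rfl (log_le_log two_pos hy2) hθ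
  rwa [hyθ] at hgr

/-- Quantitative growth bounds for one-sided bounded exterior solutions in `d = 2`. -/
theorem stmt9 :
    ∃ η₀ : ℝ, 0 < η₀ ∧ ∃ C : ℝ, 1 ≤ C ∧
      ∀ v : EuclideanSpace ℝ (Fin 2) → ℝ,
        IsHodSol 2 (by norm_num) v (extDom 2 (by norm_num)) →
        (∀ y ∈ extDom 2 (by norm_num), ‖fderiv ℝ v y‖ ≤ η₀) →
        ((∃ m : ℝ, ∀ y ∈ extDom 2 (by norm_num), m ≤ v y) →
          ∀ y ∈ extDom 2 (by norm_num), 2 ≤ ‖y‖ →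
            0 ≤ v y - sInf (v '' upSphere 2 (by norm_num) 1) ∧
            v y - sInf (v '' upSphere 2 (by norm_num) 1) ≤
              C * (1 + Real.log ‖y‖) *
                (sInf (v '' upSphere 2 (by norm_num) 2) -
                  sInf (v '' upSphere 2 (by norm_num) 1))) ∧
        ((∃ M : ℝ, ∀ y ∈ extDom 2 (by norm_num), v y ≤ M) →
          ∀ y ∈ extDom 2 (by norm_num), 2 ≤ ‖y‖ →
            v y - sSup (v '' upSphere 2 (by norm_num) 1) ≤ 0 ∧
            -(C * (1 + Real.log ‖y‖) *
                (sSup (v '' upSphere 2 (by norm_num) 1) -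
                  sSup (v '' upSphere 2 (by norm_num) 2))) ≤
              v y - sSup (v '' upSphere 2 (by norm_num) 1)) := by
  obtain ⟨δ₁, hδ₁, -, F₁, F₂, F₁p, F₁q, F₂p, F₂q, hF⟩ := exists_isFlux (σ := 1) (Or.inl rfl)
  obtain ⟨δ₂, hδ₂, -, G₁, G₂, G₁p, G₁q, G₂p, G₂q, hG⟩ := exists_isFlux (σ := -1) (Or.inr rfl)
  refine ⟨min (1 / 100000) (min δ₁ δ₂), by positivity, 12 * exp 2000002, ?_, ?_⟩
  · linarith [one_le_exp (show (0 : ℝ) ≤ 2000002 by norm_num)]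
  intro v hv hgrad
  constructor
  · rintro ⟨m, hm⟩ y hy hy2
    obtain ⟨m₁, m₂, l1, l2, hgr⟩ := hv.growth (Or.inl rfl) hF
      ((min_le_right _ _).trans (min_le_left _ _)) (min_le_left _ _) hgrad
      (fun y hy => by rw [one_mul]; exact hm y hy)
    simp only [one_mul] at l1 l2 hgr
    rw [l1.csInf_eq, l2.csInf_eq]
    exact hgr y hy hy2
  · rintro ⟨M, hM⟩ y hy hy2
    obtain ⟨m₁, m₂, l1, l2, hgr⟩ := hv.growth (B := -M) (Or.inr rfl) hG
      ((min_le_right _ _).trans (min_le_right _ _)) (min_le_left _ _) hgrad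
      (fun y hy => by linarith [hM y hy])
    have hsup : ∀ {S : Set (EuclideanSpace ℝ (Fin 2))} {m : ℝ},
        IsLeast ((fun y => -1 * v y) '' S) m → sSup (v '' S) = -m := by
      rintro S _ ⟨⟨x, hx, rfl⟩, hlb⟩
      refine IsGreatest.csSup_eq ⟨⟨x, hx, by ring⟩, ?_⟩
      rintro _ ⟨t, ht, rfl⟩
      have := hlb ⟨t, ht, rfl⟩
      linarith
    rw [hsup l1, hsup l2]
    obtain ⟨ha, hb⟩ := hgr y hy hy2
    constructor <;> linarith
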